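/- arXiv:2203.00406 — 3 statements merged into one kernel-verified Lean document; each statement's English description precedes it below -/
import Mathlib

section
/- Let A ∈ M̂_{m×n} be nonzero and let C₁, C₂ be channels of A with C₁ ∩ C₂ ≠ ∅. If the channel numberings satisfy d^{C₁}_A(c) = d^{C₂}_A(c) for all c ∈ C₁ ∩ C₂, then d^{C₁}_A = d^{C₂}_A on all of supp(A). -/
open scoped Classical

namespace AffineRSK

/-- `ℤ × ℤ`-matrices with non-negative integer entries. -/
abbrev Mat : Type := ℤ → ℤ → ℕ

abbrev Cell : Type := ℤ × ℤ

/-- Generalized affine permutations of period `(m, n)`: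
`a_{i+m, j+n} = a_{ij}` and each column has finite support. -/
def IsGAP (m n : ℕ) (A : Mat) : Prop :=
  (∀ i j : ℤ, A (i + m) (j + n) = A i j) ∧ ∀ j : ℤ, {i : ℤ | A i j ≠ 0}.Finite

/-- Generalized dual affine permutations: entries in `{0, 1}`. -/
def IsGDAP (m n : ℕ) (A : Mat) : Prop :=
  IsGAP m n A ∧ ∀ i j : ℤ, A i j ≤ 1

def supp (A : Mat) : Set Cell := {c : Cell | A c.1 c.2 ≠ 0}

def tauC (m n : ℕ) (c : Cell) : Cell := (c.1 + (m : ℤ), c.2 + (n : ℤ))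

/-- `NW c₁ c₂` means `c₁ >_NW c₂`. -/
def NW (c₁ c₂ : Cell) : Prop := c₁.1 < c₂.1 ∧ c₁.2 < c₂.2

/-- `nwGe c₁ c₂` means `c₁ ≥_nw c₂`. -/
def nwGe (c₁ c₂ : Cell) : Prop := c₁.1 ≤ c₂.1 ∧ c₁.2 ≤ c₂.2

/-- `neLe c₁ c₂` means `c₁ ≤_ne c₂`. -/
def neLe (c₁ c₂ : Cell) : Prop := c₂.1 ≤ c₁.1 ∧ c₁.2 ≤ c₂.2

/-- `nWgt c₁ c₂` means `c₁ >_nW c₂` (dual order). -/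
def nWgt (c₁ c₂ : Cell) : Prop := c₁.1 ≤ c₂.1 ∧ c₁.2 < c₂.2

/-- `NeLt c₁ c₂` means `c₁ <_Ne c₂` (dual order). -/
def NeLt (c₁ c₂ : Cell) : Prop := c₂.1 < c₁.1 ∧ c₁.2 ≤ c₂.2

/-- A proper numbering on `A`. -/
def IsProper (A : Mat) (d : Cell → ℤ) : Prop :=
  (∀ c₁ ∈ supp A, ∀ c₂ ∈ supp A, NW c₂ c₁ → d c₂ < d c₁) ∧
    ∀ c₁ ∈ supp A, ∃ c₂ ∈ supp A, NW c₂ c₁ ∧ d c₂ = d c₁ - 1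

/-- A dual proper numbering on `A`. -/
def IsProper' (A : Mat) (d : Cell → ℤ) : Prop :=
  (∀ c₁ ∈ supp A, ∀ c₂ ∈ supp A, nWgt c₂ c₁ → d c₂ < d c₁) ∧
    ∀ c₁ ∈ supp A, ∃ c₂ ∈ supp A, nWgt c₂ c₁ ∧ d c₂ = d c₁ - 1

/-- An enumeration of a stream of flow `l`. -/
def IsStreamEnum (m n : ℕ) (e : ℤ → Cell) (l : ℕ) : Prop :=
  0 < l ∧ (∀ i : ℤ, NW (e i) (e (i + 1))) ∧ ∀ i : ℤ, tauC m n (e i) = e (i + l)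

def IsStreamEnum' (m n : ℕ) (e : ℤ → Cell) (l : ℕ) : Prop :=
  0 < l ∧ (∀ i : ℤ, nWgt (e i) (e (i + 1))) ∧ ∀ i : ℤ, tauC m n (e i) = e (i + l)

def IsStream (m n : ℕ) (S : Set Cell) (l : ℕ) : Prop :=
  ∃ e : ℤ → Cell, IsStreamEnum m n e l ∧ Set.range e = S

def IsStream' (m n : ℕ) (S : Set Cell) (l : ℕ) : Prop :=
  ∃ e : ℤ → Cell, IsStreamEnum' m n e l ∧ Set.range e = S

/-- A channel of `A`: a stream contained in `supp A` of maximal flow. -/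
def IsChannel (m n : ℕ) (A : Mat) (C : Set Cell) : Prop :=
  ∃ l : ℕ, IsStream m n C l ∧ C ⊆ supp A ∧
    ∀ (S : Set Cell) (l' : ℕ), IsStream m n S l' → S ⊆ supp A → l' ≤ l

def IsChannel' (m n : ℕ) (A : Mat) (C : Set Cell) : Prop :=
  ∃ l : ℕ, IsStream' m n C l ∧ C ⊆ supp A ∧
    ∀ (S : Set Cell) (l' : ℕ), IsStream' m n S l' → S ⊆ supp A → l' ≤ l

def Csw (A : Mat) (C : Set Cell) : Set Cell :=
  {c ∈ supp A | ∃ c' ∈ C, neLe c c'}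

def Csw' (A : Mat) (C : Set Cell) : Set Cell :=
  {c ∈ supp A | c ∈ C ∨ ∃ c' ∈ C, NeLt c c'}

/-- `swGe A C₁ C₂` means `C₁ ≽_sw C₂`. -/
def swGe (A : Mat) (C₁ C₂ : Set Cell) : Prop := C₁ ⊆ Csw A C₂

def swGe' (A : Mat) (C₁ C₂ : Set Cell) : Prop := C₁ ⊆ Csw' A C₂

/-- The set of values `d₀(c'_k) + k` over `>_NW`-chains from `c` to the channel
enumerated by `e` (where `d₀ (e idx) = idx`). -/
def chainSet (A : Mat) (e : ℤ → Cell) (c : Cell) : Set ℤ :=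
  {v : ℤ | ∃ (k : ℕ) (ch : ℕ → Cell),
      ch 0 = c ∧ (∀ i ≤ k, ch i ∈ supp A) ∧ (∀ i < k, NW (ch (i + 1)) (ch i)) ∧
        ∃ idx : ℤ, e idx = ch k ∧ v = idx + (k : ℤ)}

def chainSet' (A : Mat) (e : ℤ → Cell) (c : Cell) : Set ℤ :=
  {v : ℤ | ∃ (k : ℕ) (ch : ℕ → Cell),
      ch 0 = c ∧ (∀ i ≤ k, ch i ∈ supp A) ∧ (∀ i < k, nWgt (ch (i + 1)) (ch i)) ∧
        ∃ idx : ℤ, e idx = ch k ∧ v = idx + (k : ℤ)}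

/-- `d` is the channel numbering `d^C_A` for the channel enumerated by `e`. -/
def IsChannelNumbering (A : Mat) (e : ℤ → Cell) (d : Cell → ℤ) : Prop :=
  ∀ c ∈ supp A, IsGreatest (chainSet A e c) (d c)

def IsChannelNumbering' (A : Mat) (e : ℤ → Cell) (d : Cell → ℤ) : Prop :=
  ∀ c ∈ supp A, IsGreatest (chainSet' A e c) (d c)

/-- `e` enumerates the southwest channel of `A`. -/
def IsSWChannelEnum (m n : ℕ) (A : Mat) (e : ℤ → Cell) : Prop :=
  (∃ l : ℕ, IsStreamEnum m n e l) ∧ IsChannel m n A (Set.range e) ∧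
    ∀ C : Set Cell, IsChannel m n A C → swGe A (Set.range e) C

def IsSWChannelEnum' (m n : ℕ) (A : Mat) (e : ℤ → Cell) : Prop :=
  (∃ l : ℕ, IsStreamEnum' m n e l) ∧ IsChannel' m n A (Set.range e) ∧
    ∀ C : Set Cell, IsChannel' m n A C → swGe' A (Set.range e) C

/-- `d` is a southwest channel numbering of `A`. -/
def IsSWNumbering (m n : ℕ) (A : Mat) (d : Cell → ℤ) : Prop :=
  ∃ e : ℤ → Cell, IsSWChannelEnum m n A e ∧ IsChannelNumbering A e d

def IsSWNumbering' (m n : ℕ) (A : Mat) (d : Cell → ℤ) : Prop :=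
  ∃ e : ℤ → Cell, IsSWChannelEnum' m n A e ∧ IsChannelNumbering' A e d

/-- A zig-zag: bi-infinite east/north lattice path, eventually east on the
right and coming from the south on the left. -/
def IsZigZag (z : ℤ → Cell) : Prop :=
  (∀ i : ℤ, z (i + 1) = ((z i).1, (z i).2 + 1) ∨ z (i + 1) = ((z i).1 - 1, (z i).2)) ∧
  (∃ N : ℤ, ∀ i : ℤ, N ≤ i → z (i + 1) = ((z i).1, (z i).2 + 1)) ∧
    ∃ N : ℤ, ∀ i : ℤ, i ≤ N → z (i + 1) = ((z i).1 - 1, (z i).2)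

def innerCorners (z : ℤ → Cell) : Set Cell :=
  {c : Cell | ∃ i : ℤ, z i = c ∧ z i = ((z (i - 1)).1 - 1, (z (i - 1)).2) ∧
      z (i + 1) = ((z i).1, (z i).2 + 1)}

def outerCorners (z : ℤ → Cell) : Set Cell :=
  {c : Cell | ∃ i : ℤ, z i = c ∧ z i = ((z (i - 1)).1, (z (i - 1)).2 + 1) ∧
      z (i + 1) = ((z i).1 - 1, (z i).2)}

def levelSet (A : Mat) (d : Cell → ℤ) (k : ℤ) : Set Cell := {c ∈ supp A | d c = k}

/-- `≥_nw`-maximal cells of `S`. -/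
def nwMaximal (S : Set Cell) : Set Cell := {c ∈ S | ∀ c' ∈ S, nwGe c' c → c' = c}

/-- `>_nW`-maximal cells of `S` (dual). -/
def nWMaximal (S : Set Cell) : Set Cell := {c ∈ S | ∀ c' ∈ S, ¬ nWgt c' c}

/-- `z` is the zig-zag at level `k` associated to the numbering `d`. -/
def ZigZagAt (A : Mat) (d : Cell → ℤ) (k : ℤ) (z : ℤ → Cell) : Prop :=
  IsZigZag z ∧ innerCorners z = nwMaximal (levelSet A d k)

def ZigZagAt' (A : Mat) (d : Cell → ℤ) (k : ℤ) (z : ℤ → Cell) : Prop :=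
  IsZigZag z ∧ innerCorners z = nWMaximal (levelSet A d k)

def IsInnerOf (A : Mat) (d : Cell → ℤ) (c : Cell) : Prop :=
  ∃ (k : ℤ) (z : ℤ → Cell), ZigZagAt A d k z ∧ c ∈ innerCorners z

def IsOuterOf (A : Mat) (d : Cell → ℤ) (c : Cell) : Prop :=
  ∃ (k : ℤ) (z : ℤ → Cell), ZigZagAt A d k z ∧ c ∈ outerCorners z

def IsInnerOf' (A : Mat) (d : Cell → ℤ) (c : Cell) : Prop :=
  ∃ (k : ℤ) (z : ℤ → Cell), ZigZagAt' A d k z ∧ c ∈ innerCorners z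

def IsOuterOf' (A : Mat) (d : Cell → ℤ) (c : Cell) : Prop :=
  ∃ (k : ℤ) (z : ℤ → Cell), ZigZagAt' A d k z ∧ c ∈ outerCorners z

/-- `B` is obtained from `A` by subtracting `1` at inner corners and adding `1`
at outer corners. -/
def FlatEntries (A B : Mat) (Inn Out : Cell → Prop) : Prop :=
  ∀ c : Cell,
    (Inn c → B c.1 c.2 + 1 = A c.1 c.2) ∧
    (Out c → B c.1 c.2 = A c.1 c.2 + 1) ∧
    (¬ Inn c → ¬ Out c → B c.1 c.2 = A c.1 c.2)

/-- `B = A^♭`. -/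
def FlatRel (m n : ℕ) (A B : Mat) : Prop :=
  ∃ d : Cell → ℤ, IsSWNumbering m n A d ∧
    FlatEntries A B (IsInnerOf A d) (IsOuterOf A d)

/-- `B = A^{♭'}` (dual). -/
def FlatRel' (m n : ℕ) (A B : Mat) : Prop :=
  ∃ d : Cell → ℤ, IsSWNumbering' m n A d ∧
    FlatEntries A B (IsInnerOf' A d) (IsOuterOf' A d)

/-- `c` is the back-post corner of the zig-zag `z`:
`(row of rightmost inner corner, column of leftmost inner corner)`. -/
def IsBackPost (z : ℤ → Cell) (c : Cell) : Prop :=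
  ∃ cr ∈ innerCorners z, ∃ cl ∈ innerCorners z,
    (∀ c' ∈ innerCorners z, c'.2 ≤ cr.2) ∧ (∀ c' ∈ innerCorners z, cl.2 ≤ c'.2) ∧
      c = (cr.1, cl.2)

def backPostSet (A : Mat) (d : Cell → ℤ) : Set Cell :=
  {c : Cell | ∃ (k : ℤ) (z : ℤ → Cell), ZigZagAt A d k z ∧ IsBackPost z c}

def backPostSet' (A : Mat) (d : Cell → ℤ) : Set Cell :=
  {c : Cell | ∃ (k : ℤ) (z : ℤ → Cell), ZigZagAt' A d k z ∧ IsBackPost z c}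

/-- Defining data `(a, b, r)` of the stream enumerated by `e` of flow `l`. -/
def StreamData (m n : ℕ) (e : ℤ → Cell) (l : ℕ) (a b : ℕ → ℤ) (r : ℤ) : Prop :=
  ∃ r₁ r₂ : ℤ,
    (∀ p : ℕ, p < l → a p = (e (r₁ + 1 + p)).1 ∧ 1 ≤ a p ∧ a p ≤ (m : ℤ)) ∧
    (∀ p : ℕ, p < l → b p = (e (r₂ + 1 + p)).2 ∧ 1 ≤ b p ∧ b p ≤ (n : ℤ)) ∧
      r = r₁ - r₂

/-- The matrix-ball iteration `A = A^(0), A^(t) = (A^(t-1))^♭`, with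
`A^(t) ≠ O` for `t < s` and `A^(s) = O`. -/
def MBCseq (m n : ℕ) (A : Mat) (s : ℕ) (Aseq : ℕ → Mat) : Prop :=
  Aseq 0 = A ∧ (∀ t < s, Aseq t ≠ 0) ∧ Aseq s = 0 ∧
    ∀ t < s, FlatRel m n (Aseq t) (Aseq (t + 1))

def MBCseq' (m n : ℕ) (A : Mat) (s : ℕ) (Aseq : ℕ → Mat) : Prop :=
  Aseq 0 = A ∧ (∀ t < s, Aseq t ≠ 0) ∧ Aseq s = 0 ∧
    ∀ t < s, FlatRel' m n (Aseq t) (Aseq (t + 1))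

/-- `κ₀(A) = (P, Q, ρ)`, with shape given by the column lengths `μ`:
the `t`-th columns (from the left, `0`-based) of `P` and `Q` are the defining
data of the stream of back-post corners of the zig-zags of `d^{sw}_{A^(t)}`. -/
def Kappa0Rel (m n : ℕ) (A : Mat) (s : ℕ) (μ : ℕ → ℕ) (P Q : ℕ → ℕ → ℤ)
    (ρ : ℕ → ℤ) : Prop :=
  ∃ Aseq : ℕ → Mat, MBCseq m n A s Aseq ∧
    ∀ t < s, ∃ (d : Cell → ℤ) (e : ℤ → Cell),
      IsSWNumbering m n (Aseq t) d ∧ IsStreamEnum m n e (μ t) ∧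
        Set.range e = backPostSet (Aseq t) d ∧
        StreamData m n e (μ t) (fun x => P x t) (fun x => Q x t) (ρ t)

def Kappa0Rel' (m n : ℕ) (A : Mat) (s : ℕ) (μ : ℕ → ℕ) (P Q : ℕ → ℕ → ℤ)
    (ρ : ℕ → ℤ) : Prop :=
  ∃ Aseq : ℕ → Mat, MBCseq' m n A s Aseq ∧
    ∀ t < s, ∃ (d : Cell → ℤ) (e : ℤ → Cell),
      IsSWNumbering' m n (Aseq t) d ∧ IsStreamEnum' m n e (μ t) ∧
        Set.range e = backPostSet' (Aseq t) d ∧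
        StreamData m n e (μ t) (fun x => P x t) (fun x => Q x t) (ρ t)

/-! ### Columns and the shift `τ` -/

/-- Extension of a column `c` of length `b` to `ℤ`: `c̃(x + bq) = c(x) + nq`. -/
def colExt (n b : ℕ) (c : ℕ → ℤ) (z : ℤ) : ℤ :=
  c (Int.toNat (Int.emod z (b : ℤ))) + (n : ℤ) * Int.ediv z (b : ℤ)

/-- `τ_n^k` applied to a column of length `b`. -/
def tauPow (n b : ℕ) (k : ℤ) (c : ℕ → ℤ) : ℕ → ℤ :=
  fun x => colExt n b c ((x : ℤ) + k)

/-- The two-column tableau `(column t of T, τ_N^r(column (t+1) of T))`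
(both of height `μ t`) is `ℤ`-semistandard. -/
def pairCond (N : ℕ) (μ : ℕ → ℕ) (T : ℕ → ℕ → ℤ) (t : ℕ) (r : ℕ) : Prop :=
  (∀ x : ℕ, x + 1 < μ t → T x t < T (x + 1) t) ∧
  (∀ x : ℕ, x + 1 < μ t →
    tauPow N (μ t) (r : ℤ) (fun y => T y (t + 1)) x <
      tauPow N (μ t) (r : ℤ) (fun y => T y (t + 1)) (x + 1)) ∧
    ∀ x < μ t, T x t ≤ tauPow N (μ t) (r : ℤ) (fun y => T y (t + 1)) x

/-- The offset `r` for the adjacent pair of columns `(t, t+1)`. -/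
noncomputable def rOff (N : ℕ) (μ : ℕ → ℕ) (T : ℕ → ℕ → ℤ) (t : ℕ) : ℕ :=
  sInf {r : ℕ | pairCond N μ T t r}

/-- Dual version: placing row `t` above row `τ_N^r(row (t+1))` (rows of the
transposed tableau, i.e. columns of `T`) is `ℤ`-semistandard. -/
def dualPairCond (N : ℕ) (μ : ℕ → ℕ) (T : ℕ → ℕ → ℤ) (t : ℕ) (r : ℕ) : Prop :=
  (∀ x : ℕ, x + 1 < μ t → T x t ≤ T (x + 1) t) ∧
  (∀ x : ℕ, x + 1 < μ t →
    tauPow N (μ t) (r : ℤ) (fun y => T y (t + 1)) x ≤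
      tauPow N (μ t) (r : ℤ) (fun y => T y (t + 1)) (x + 1)) ∧
    ∀ x < μ t, T x t < tauPow N (μ t) (r : ℤ) (fun y => T y (t + 1)) x

noncomputable def rOffDual (N : ℕ) (μ : ℕ → ℕ) (T : ℕ → ℕ → ℤ) (t : ℕ) : ℕ :=
  sInf {r : ℕ | dualPairCond N μ T t r}

/-- First column of the rectangle block containing column `t`. -/
noncomputable def blockStart (μ : ℕ → ℕ) (t : ℕ) : ℕ := sInf {t' : ℕ | μ t' = μ t}

/-- The symmetrized offset entry attached to column `t`
(`η_j` where `j` is the position of `t` from the right in its block). -/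
noncomputable def etaCol (N : ℕ) (μ : ℕ → ℕ) (T : ℕ → ℕ → ℤ) (t : ℕ) : ℕ :=
  ∑ u ∈ Finset.Ico (blockStart μ t) t, rOff N μ T u

noncomputable def etaColDual (N : ℕ) (μ : ℕ → ℕ) (T : ℕ → ℕ → ℤ) (t : ℕ) : ℕ :=
  ∑ u ∈ Finset.Ico (blockStart μ t) t, rOffDual N μ T u

/-- Entries outside the shape are normalized to `0`. -/
def PadZeroT (s : ℕ) (μ : ℕ → ℕ) (T : ℕ → ℕ → ℤ) : Prop :=
  ∀ x t : ℕ, s ≤ t ∨ μ t ≤ x → T x t = 0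

/-- `μ` encodes (the conjugate of) a partition `λ ∈ 𝒫_m ∩ 𝒫_n` with `s` columns. -/
def ShapeOK (m n s : ℕ) (μ : ℕ → ℕ) : Prop :=
  (∀ t : ℕ, t + 1 < s → μ (t + 1) ≤ μ t) ∧ (∀ t < s, 0 < μ t ∧ μ t ≤ m ∧ μ t ≤ n) ∧
    ∀ t : ℕ, s ≤ t → μ t = 0

/-- Dual shape condition: `λ ∈ 𝒫_n`. -/
def ShapeOK' (n s : ℕ) (μ : ℕ → ℕ) : Prop :=
  (∀ t : ℕ, t + 1 < s → μ (t + 1) ≤ μ t) ∧ (∀ t < s, 0 < μ t ∧ μ t ≤ n) ∧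
    ∀ t : ℕ, s ≤ t → μ t = 0

/-- `κ(A) = (P, Q)` where `Q` is obtained by shifting the `t`-th column of `Q₀`
by `τ_n^{ρ_t + η_t}` (`η` the symmetrized offset vector of `P₀`). -/
def KappaRel (m n : ℕ) (A : Mat) (s : ℕ) (μ : ℕ → ℕ) (P Q : ℕ → ℕ → ℤ) : Prop :=
  ∃ (P' Q' : ℕ → ℕ → ℤ) (ρ : ℕ → ℤ),
    Kappa0Rel m n A s μ P' Q' ρ ∧
    (∀ t < s, ∀ x < μ t,
      P x t = P' x t ∧
        Q x t = tauPow n (μ t) (ρ t + (etaCol m μ P' t : ℤ)) (fun y => Q' y t) x) ∧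
    PadZeroT s μ P ∧ PadZeroT s μ Q ∧ ∀ t : ℕ, s ≤ t → μ t = 0

def KappaRel' (m n : ℕ) (A : Mat) (s : ℕ) (μ : ℕ → ℕ) (P Q : ℕ → ℕ → ℤ) : Prop :=
  ∃ (P' Q' : ℕ → ℕ → ℤ) (ρ : ℕ → ℤ),
    Kappa0Rel' m n A s μ P' Q' ρ ∧
    (∀ t < s, ∀ x < μ t,
      P x t = P' x t ∧
        Q x t = tauPow n (μ t) (ρ t + (etaColDual m μ P' t : ℤ)) (fun y => Q' y t) x) ∧
    PadZeroT s μ P ∧ PadZeroT s μ Q ∧ ∀ t : ℕ, s ≤ t → μ t = 0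

/-- Membership in `⨆_{λ ∈ 𝒫_m ∩ 𝒫_n} CSST_[m](λ) × B_n(λ)`:
`P` is column semistandard with entries in `{1, …, m}` and `Q` is a
`ℤ`-semistandard filling whose columns span less than `n` and whose rows
weakly increase within each rectangle block. -/
def InTargetRSK (m n s : ℕ) (μ : ℕ → ℕ) (P Q : ℕ → ℕ → ℤ) : Prop :=
  ShapeOK m n s μ ∧ PadZeroT s μ P ∧ PadZeroT s μ Q ∧
  (∀ t < s, ∀ x : ℕ, x + 1 < μ t → P x t < P (x + 1) t) ∧
  (∀ t < s, ∀ x < μ t, 1 ≤ P x t ∧ P x t ≤ (m : ℤ)) ∧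
  (∀ t < s, ∀ x : ℕ, x + 1 < μ t → Q x t < Q (x + 1) t) ∧
  (∀ t < s, Q (μ t - 1) t - Q 0 t < (n : ℤ)) ∧
    ∀ t : ℕ, t + 1 < s → μ t = μ (t + 1) → ∀ x < μ t, Q x t ≤ Q x (t + 1)

/-- Membership in `⨆_{λ ∈ 𝒫_n} RSST_[m](λ') × B_n(λ)`; the first component is
encoded by `P = P₀` (whose columns, weakly increasing with entries in
`{1, …, m}`, are the rows of `P₀ᵗ ∈ RSST_[m](λ')`). -/
def InTargetDual (m n s : ℕ) (μ : ℕ → ℕ) (P Q : ℕ → ℕ → ℤ) : Prop :=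
  ShapeOK' n s μ ∧ PadZeroT s μ P ∧ PadZeroT s μ Q ∧
  (∀ t < s, ∀ x : ℕ, x + 1 < μ t → P x t ≤ P (x + 1) t) ∧
  (∀ t < s, ∀ x < μ t, 1 ≤ P x t ∧ P x t ≤ (m : ℤ)) ∧
  (∀ t < s, ∀ x : ℕ, x + 1 < μ t → Q x t < Q (x + 1) t) ∧
  (∀ t < s, Q (μ t - 1) t - Q 0 t < (n : ℤ)) ∧
    ∀ t : ℕ, t + 1 < s → μ t = μ (t + 1) → ∀ x < μ t, Q x t ≤ Q x (t + 1)

/-- Dominance of a triple `(P, Q, ρ)`: within each rectangle block, the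
sequence `ρ - ζ` (read right to left) is weakly decreasing, where
`ζ = θ - η` with `η`, `θ` the symmetrized offset vectors of `P`, `Q`. -/
def Dominant (m n s : ℕ) (μ : ℕ → ℕ) (P Q : ℕ → ℕ → ℤ) (ρ : ℕ → ℤ) : Prop :=
  ∀ t : ℕ, t + 1 < s → μ t = μ (t + 1) →
    ρ t - ((etaCol n μ Q t : ℤ) - (etaCol m μ P t : ℤ)) ≤
      ρ (t + 1) - ((etaCol n μ Q (t + 1) : ℤ) - (etaCol m μ P (t + 1) : ℤ))

/-- `κ₀(A) = (P, Q, ρ)` with all data normalized outside the shape. -/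
def Kappa0RelPad (m n : ℕ) (A : Mat) (s : ℕ) (μ : ℕ → ℕ) (P Q : ℕ → ℕ → ℤ)
    (ρ : ℕ → ℤ) : Prop :=
  ∃ P' Q' : ℕ → ℕ → ℤ,
    Kappa0Rel m n A s μ P' Q' ρ ∧
    (∀ t < s, ∀ x < μ t, P x t = P' x t ∧ Q x t = Q' x t) ∧
    PadZeroT s μ P ∧ PadZeroT s μ Q ∧ (∀ t : ℕ, s ≤ t → μ t = 0) ∧
      ∀ t : ℕ, s ≤ t → ρ t = 0

/-- Membership in `Ω_dom`. -/
def InOmegaDom (m n s : ℕ) (μ : ℕ → ℕ) (P Q : ℕ → ℕ → ℤ) (ρ : ℕ → ℤ) : Prop :=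
  ShapeOK m n s μ ∧ PadZeroT s μ P ∧ PadZeroT s μ Q ∧ (∀ t : ℕ, s ≤ t → ρ t = 0) ∧
  (∀ t < s, ∀ x : ℕ, x + 1 < μ t → P x t < P (x + 1) t) ∧
  (∀ t < s, ∀ x < μ t, 1 ≤ P x t ∧ P x t ≤ (m : ℤ)) ∧
  (∀ t < s, ∀ x : ℕ, x + 1 < μ t → Q x t < Q (x + 1) t) ∧
  (∀ t < s, ∀ x < μ t, 1 ≤ Q x t ∧ Q x t ≤ (n : ℤ)) ∧
    Dominant m n s μ P Q ρ

/-- `A` has width `l`: some proper numbering has period `l`. -/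
def HasWidth (m n : ℕ) (A : Mat) (l : ℕ) : Prop :=
  ∃ d : Cell → ℤ, IsProper A d ∧ ∀ c ∈ supp A, d (tauC m n c) = d c + (l : ℤ)

/-! ### Crystal operators on matrices -/

/-- The first `+` of column `j` (row `i`) survives the signature reduction of
the sequence `σ` attached to rows `i, i+1`. -/
def SurvPlus (A : Mat) (i j : ℤ) : Prop :=
  0 < A i j ∧ ∀ j' : ℤ, j < j' →
    (∑ t ∈ Finset.Ioc j j', A (i + 1) t) ≤ (A i j - 1) + ∑ t ∈ Finset.Ioo j j', A i t

/-- The last `-` of column `j` (row `i+1`) survives the reduction. -/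
def SurvMinus (A : Mat) (i j : ℤ) : Prop :=
  0 < A (i + 1) j ∧ ∀ j' : ℤ, j' < j →
    (∑ t ∈ Finset.Ico j' j, A i t) ≤ (A (i + 1) j - 1) + ∑ t ∈ Finset.Ioo j' j, A (i + 1) t

/-- `A - Ê_{i₁ j} + Ê_{i₂ j}`. -/
noncomputable def subAddAt (m n : ℕ) (i₁ i₂ j : ℤ) (A : Mat) : Mat :=
  fun x y =>
    if ∃ k : ℤ, x = i₁ + k * m ∧ y = j + k * n then A x y - 1
    else if ∃ k : ℤ, x = i₂ + k * m ∧ y = j + k * n then A x y + 1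
    else A x y

/-- `f̃_i` on `M̂_{m×n}`, `0`-valued results encoded by `none`. -/
noncomputable def fMat (m n : ℕ) (i : ℤ) (A : Mat) : Option Mat :=
  if h : ∃ j : ℤ, SurvPlus A i j ∧ ∀ j' : ℤ, SurvPlus A i j' → j ≤ j' then
    some (subAddAt m n i (i + 1) h.choose A)
  else none

/-- `ẽ_i` on `M̂_{m×n}`. -/
noncomputable def eMat (m n : ℕ) (i : ℤ) (A : Mat) : Option Mat :=
  if h : ∃ j : ℤ, SurvMinus A i j ∧ ∀ j' : ℤ, SurvMinus A i j' → j' ≤ j then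
    some (subAddAt m n (i + 1) i h.choose A)
  else none

def transM (A : Mat) : Mat := fun i j => A j i

/-- `f̃^t_j A = (f̃_j (Aᵗ))ᵗ`. -/
noncomputable def fMatT (m n : ℕ) (j : ℤ) (A : Mat) : Option Mat :=
  (fMat n m j (transM A)).map transM

/-- `ẽ^t_j A = (ẽ_j (Aᵗ))ᵗ`. -/
noncomputable def eMatT (m n : ℕ) (j : ℤ) (A : Mat) : Option Mat :=
  (eMat n m j (transM A)).map transM

/-- Row operator (`f̃_i` if `x = true`, `ẽ_i` if `x = false`) on `M̂ ∪ {0}`. -/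
noncomputable def rowOp (m n : ℕ) (x : Bool) (i : ℤ) (o : Option Mat) : Option Mat :=
  o.bind (if x then fMat m n i else eMat m n i)

/-- Column operator (`f̃^t_j` or `ẽ^t_j`) on `M̂ ∪ {0}`. -/
noncomputable def colOp (m n : ℕ) (y : Bool) (j : ℤ) (o : Option Mat) : Option Mat :=
  o.bind (if y then fMatT m n j else eMatT m n j)

/-- The `+` of row `u`, column `j` survives the signature reduction of the
sequence attached to columns `j, j+1` (read along rows, top to bottom). -/
def ColSurvPlus (A : Mat) (j u : ℤ) : Prop :=
  0 < A u j ∧ ∀ u' : ℤ, u < u' →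
    (∑ i ∈ Finset.Ioc u u', A i (j + 1)) ≤ (A u j - 1) + ∑ i ∈ Finset.Ioo u u', A i j

/-- `A - Ê_{u j} + Ê_{u, j+1}`, the result of `f̃^t_j` acting at row `u`. -/
noncomputable def ftApply (m n : ℕ) (u j : ℤ) (A : Mat) : Mat :=
  fun x y =>
    if ∃ k : ℤ, x = u + k * m ∧ y = j + k * n then A x y - 1
    else if ∃ k : ℤ, x = u + k * m ∧ y = j + 1 + k * n then A x y + 1
    else A x y

/-! ### Crystal operators on tableaux -/

/-- Column `t` of `P` contributes a `+` for the letter `i`. -/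
def PhasPlus (μ : ℕ → ℕ) (P : ℕ → ℕ → ℤ) (i : ℤ) (t : ℕ) : Prop :=
  (∃ x < μ t, P x t = i) ∧ ∀ x < μ t, P x t ≠ i + 1

/-- Column `t` of `P` contributes a `-` for the letter `i`. -/
def PhasMinus (μ : ℕ → ℕ) (P : ℕ → ℕ → ℤ) (i : ℤ) (t : ℕ) : Prop :=
  (∃ x < μ t, P x t = i + 1) ∧ ∀ x < μ t, P x t ≠ i

/-- The `+` of column `t` survives the tensor-product signature reduction
(factors are the columns read from right to left). -/
def PSurvPlus (μ : ℕ → ℕ) (P : ℕ → ℕ → ℤ) (i : ℤ) (t : ℕ) : Prop :=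
  PhasPlus μ P i t ∧ ∀ t' < t,
    ((Finset.Ico t' t).filter (fun u => PhasMinus μ P i u)).card ≤
      ((Finset.Ioo t' t).filter (fun u => PhasPlus μ P i u)).card

def PSurvMinus (μ : ℕ → ℕ) (P : ℕ → ℕ → ℤ) (i : ℤ) (t : ℕ) : Prop :=
  PhasMinus μ P i t ∧ ∀ t'' : ℕ, t < t'' →
    ((Finset.Ioc t t'').filter (fun u => PhasPlus μ P i u)).card ≤
      ((Finset.Ioo t t'').filter (fun u => PhasMinus μ P i u)).card

/-- `f̃_i` on `P` acting on column `t₀` (replace the letter `i` by `i + 1`). -/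
noncomputable def applyPF (μ : ℕ → ℕ) (P : ℕ → ℕ → ℤ) (i : ℤ) (t₀ : ℕ) :
    ℕ → ℕ → ℤ :=
  fun x t => if t = t₀ ∧ x < μ t ∧ P x t = i then i + 1 else P x t

/-- `ẽ_i` on `P` acting on column `t₀`. -/
noncomputable def applyPE (μ : ℕ → ℕ) (P : ℕ → ℕ → ℤ) (i : ℤ) (t₀ : ℕ) :
    ℕ → ℕ → ℤ :=
  fun x t => if t = t₀ ∧ x < μ t ∧ P x t = i + 1 then i else P x t

/-- The entry at position `k` of a column `c` of height `b` can be increased. -/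
def QmovUp (n b : ℕ) (c : ℕ → ℤ) (k : ℕ) : Prop :=
  (k + 1 < b ∧ c k + 1 < c (k + 1)) ∨ (k + 1 = b ∧ c (b - 1) < c 0 + (n : ℤ) - 1)

/-- The entry at position `k` of a column `c` of height `b` can be decreased. -/
def QmovDown (n b : ℕ) (c : ℕ → ℤ) (k : ℕ) : Prop :=
  (0 < k ∧ c (k - 1) < c k - 1) ∨ (k = 0 ∧ c (b - 1) < c 0 + (n : ℤ) - 1)

def QhasPlus (n : ℕ) (μ : ℕ → ℕ) (Q : ℕ → ℕ → ℤ) (j : ℤ) (t : ℕ) : Prop :=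
  ∃ k < μ t, Int.emod (Q k t) (n : ℤ) = j ∧ QmovUp n (μ t) (fun y => Q y t) k

def QhasMinus (n : ℕ) (μ : ℕ → ℕ) (Q : ℕ → ℕ → ℤ) (j : ℤ) (t : ℕ) : Prop :=
  ∃ k < μ t, Int.emod (Q k t) (n : ℤ) = Int.emod (j + 1) (n : ℤ) ∧
    QmovDown n (μ t) (fun y => Q y t) k

def QSurvPlus (n : ℕ) (μ : ℕ → ℕ) (Q : ℕ → ℕ → ℤ) (j : ℤ) (t : ℕ) : Prop :=
  QhasPlus n μ Q j t ∧ ∀ t' < t,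
    ((Finset.Ico t' t).filter (fun u => QhasMinus n μ Q j u)).card ≤
      ((Finset.Ioo t' t).filter (fun u => QhasPlus n μ Q j u)).card

def QSurvMinus (n : ℕ) (μ : ℕ → ℕ) (Q : ℕ → ℕ → ℤ) (j : ℤ) (t : ℕ) : Prop :=
  QhasMinus n μ Q j t ∧ ∀ t'' : ℕ, t < t'' →
    ((Finset.Ioc t t'').filter (fun u => QhasPlus n μ Q j u)).card ≤
      ((Finset.Ioo t t'').filter (fun u => QhasMinus n μ Q j u)).card

/-- `f̃^t_j` on `Q` acting on column `t₀`. -/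
noncomputable def applyQF (n : ℕ) (μ : ℕ → ℕ) (Q : ℕ → ℕ → ℤ) (j : ℤ) (t₀ : ℕ) :
    ℕ → ℕ → ℤ :=
  fun x t =>
    if t = t₀ ∧ x < μ t ∧ Int.emod (Q x t) (n : ℤ) = j ∧
        QmovUp n (μ t) (fun y => Q y t) x
    then Q x t + 1 else Q x t

/-- `ẽ^t_j` on `Q` acting on column `t₀`. -/
noncomputable def applyQE (n : ℕ) (μ : ℕ → ℕ) (Q : ℕ → ℕ → ℤ) (j : ℤ) (t₀ : ℕ) :
    ℕ → ℕ → ℤ :=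
  fun x t =>
    if t = t₀ ∧ x < μ t ∧ Int.emod (Q x t) (n : ℤ) = Int.emod (j + 1) (n : ℤ) ∧
        QmovDown n (μ t) (fun y => Q y t) x
    then Q x t - 1 else Q x t

/-! ### Standardization -/

noncomputable def rowSumA (A : Mat) (i : ℤ) : ℕ := ∑ᶠ j : ℤ, A i j

noncomputable def colSumA (A : Mat) (j : ℤ) : ℕ := ∑ᶠ i : ℤ, A i j

/-- `A ∈ M̂_{m×n}(α, β)`. -/
def InMhatAB (m n : ℕ) (α β : ℕ → ℕ) (A : Mat) : Prop :=
  IsGAP m n A ∧ (∀ i : ℕ, 1 ≤ i → i ≤ m → rowSumA A i = α i) ∧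
    ∀ j : ℕ, 1 ≤ j → j ≤ n → colSumA A j = β j

/-- Extended affine permutations `W̃_K`. -/
def IsEAP (K : ℕ) (B : Mat) : Prop :=
  IsGAP K K B ∧ (∀ i j : ℤ, B i j ≤ 1) ∧ (∀ i : ℤ, ∃! j : ℤ, B i j ≠ 0) ∧
    ∀ j : ℤ, ∃! i : ℤ, B i j ≠ 0

/-- `i` is a descent of the matrix `B`. -/
def IsDescentM (B : Mat) (i : ℤ) : Prop :=
  ∃ j j' : ℤ, B i j ≠ 0 ∧ B (i + 1) j' ≠ 0 ∧ j' < j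

/-- Partial sums `α₁ + ⋯ + α_i`. -/
def psum (α : ℕ → ℕ) (i : ℕ) : ℕ := ∑ u ∈ Finset.Icc 1 i, α u

/-- `B` is `α`-descending. -/
def AlphaDescending (m : ℕ) (α : ℕ → ℕ) (B : Mat) : Prop :=
  ∀ k : ℕ, 1 ≤ k → k ≤ m → ∀ i : ℤ,
    (psum α (k - 1) : ℤ) < i → i < (psum α k : ℤ) → IsDescentM B i

/-- `B` is `(α, β)`-descending. -/
def IsABDescending (m n : ℕ) (α β : ℕ → ℕ) (B : Mat) : Prop :=
  AlphaDescending m α B ∧ AlphaDescending n β (transM B)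

/-- `B` standardizes `A`: blockwise entry sums of `B` over `𝓘_i × 𝓙_j`
equal the entries of `A`. -/
def PermOf (m n K : ℕ) (α β : ℕ → ℕ) (A B : Mat) : Prop :=
  ∀ (i₀ j₀ : ℕ) (q r : ℤ), 1 ≤ i₀ → i₀ ≤ m → 1 ≤ j₀ → j₀ ≤ n →
    A ((i₀ : ℤ) + q * m) ((j₀ : ℤ) + r * n) =
      ∑ k ∈ Finset.Icc ((psum α (i₀ - 1) : ℤ) + q * K + 1) ((psum α i₀ : ℤ) + q * K),
        ∑ l ∈ Finset.Icc ((psum β (j₀ - 1) : ℤ) + r * K + 1) ((psum β j₀ : ℤ) + r * K),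
          B k l

/-- Standardization of a column-semistandard tableau: for each value `v`, its
occurrences, from left to right, are replaced by consecutive integers starting
after the number of strictly smaller entries. -/
noncomputable def stdT (s : ℕ) (μ : ℕ → ℕ) (T : ℕ → ℕ → ℤ) : ℕ → ℕ → ℤ :=
  fun x t =>
    ((∑ t' ∈ Finset.range s,
        ((Finset.range (μ t')).filter (fun x' => T x' t' < T x t)).card : ℕ) : ℤ) +
      (((Finset.range t).filter (fun t' => ∃ x' < μ t', T x' t' = T x t)).card : ℤ) + 1

/-- `i` is a (column) descent of the tableau `T`: the letter `i + 1` occurs in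
a column strictly to the right of the column containing `i`. -/
def IsDescentT (s : ℕ) (μ : ℕ → ℕ) (T : ℕ → ℕ → ℤ) (i : ℤ) : Prop :=
  ∃ t < s, ∃ t' < s, ∃ x < μ t, ∃ x' < μ t', T x t = i ∧ T x' t' = i + 1 ∧ t < t'

/-! ### Rectangles, `B_n(R)` and `B_n(R)₀` (columns indexed from the right) -/

/-- `T ∈ B_n(R)` for the rectangle `R = (a^b)`; `T j x` is the entry at row `x`
of the `(j+1)`-st column from the right, normalized to `0` outside the shape. -/
def InBnR (n a b : ℕ) (T : ℕ → ℕ → ℤ) : Prop :=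
  (∀ j : ℕ, j + 1 < a → ∀ x < b, T (j + 1) x ≤ T j x) ∧
  (∀ j < a, ∀ x : ℕ, x + 1 < b → T j x < T j (x + 1)) ∧
  (∀ j < a, T j (b - 1) - T j 0 < (n : ℤ)) ∧
    ∀ j x : ℕ, a ≤ j ∨ b ≤ x → T j x = 0

/-- `T ∈ B_n(R)₀`: `(T^{j+1}, τ_n^{-1}(T^j))` is not semistandard for any `j`. -/
def InBnR0 (n a b : ℕ) (T : ℕ → ℕ → ℤ) : Prop :=
  InBnR n a b T ∧
    ∀ j : ℕ, j + 1 < a → ¬ ∀ x < b, T (j + 1) x ≤ tauPow n b (-1) (fun y => T j y) x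

/-- `ν ∈ 𝒫_{a-1}`: a partition `ν₁ ≥ ⋯ ≥ ν_{a-1} ≥ 0`, normalized. -/
def IsPartLen (a : ℕ) (ν : ℕ → ℕ) : Prop :=
  ν 0 = 0 ∧ (∀ j : ℕ, 1 ≤ j → j + 2 ≤ a → ν (j + 1) ≤ ν j) ∧ ∀ j : ℕ, a ≤ j → ν j = 0

/-- `(T, ν) ↦ τ_n^{ν_rev}(T)`: the column `j` (from the right, 0-based) is
shifted by `τ_n^{ν_{j+1}}`. -/
noncomputable def PhiMap (n a b : ℕ) (T : ℕ → ℕ → ℤ) (ν : ℕ → ℕ) : ℕ → ℕ → ℤ :=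
  fun j x => if j < a ∧ x < b then tauPow n b ((ν (j + 1) : ℤ)) (fun y => T j y) x else 0

/-- The offset `r_j` of `T` (columns from the right, paper indexing `j ≥ 1`). -/
noncomputable def rOffR (n b : ℕ) (T : ℕ → ℕ → ℤ) (j : ℕ) : ℕ :=
  sInf {r : ℕ | ∀ x < b, T j x ≤ tauPow n b ((r : ℤ)) (fun y => T (j - 1) y) x}

/-- The symmetrized offset `η_j = r_j + ⋯ + r_{a-1}`. -/
noncomputable def etaR (n a b : ℕ) (T : ℕ → ℕ → ℤ) (j : ℕ) : ℕ :=
  ∑ u ∈ Finset.Icc j (a - 1), rOffR n b T u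

/-! ### The two-column setup -/

/-- Row coordinates of the stream with defining data `(a, ·, ρ)`:
`X(p + ρ + ql) = a(p) + qm` for `1 ≤ p ≤ l`. -/
def streamX (m l : ℕ) (a : ℕ → ℤ) (ρ : ℤ) (idx : ℤ) : ℤ := colExt m l a (idx - ρ - 1)

/-- Column coordinates: `Y(p + ql) = b(p) + qn` for `1 ≤ p ≤ l`. -/
def streamY (n l : ℕ) (b : ℕ → ℤ) (idx : ℤ) : ℤ := colExt n l b (idx - 1)

/-- The matrix built from the interleaved streams `t` and `t'`. -/
noncomputable def twoColMat (m n l : ℕ) (a1 a2 b1 b2 : ℕ → ℤ) (ρ₁ ρ₂ k : ℤ) : Mat :=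
  fun x y =>
    (if ∃ i : ℤ, streamX m l a2 ρ₂ (i + k) = x ∧ streamY n l b1 i = y then 1 else 0) +
      (if ∃ i : ℤ, streamX m l a1 ρ₁ i = x ∧ streamY n l b2 (i + k) = y then 1 else 0)


theorem step_aux {A : Mat} {e : ℤ → Cell} {d : Cell → ℤ} (hd : IsChannelNumbering A e d)
    {c c' : Cell} (hc : c ∈ supp A) (hc' : c' ∈ supp A) (h : NW c' c) : d c' + 1 ≤ d c := by
  obtain ⟨k, ch, h0, hs, hnw, idx, hidx, hv⟩ := (hd c' hc').1
  apply (hd c hc).2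
  refine ⟨k + 1, fun i => if i = 0 then c else ch (i - 1), by simp, ?_, ?_, idx, by simp [hidx], ?_⟩
  · intro i hi
    rcases i with _ | i
    · simpa using hc
    · simpa using hs i (by omega)
  · intro i hi
    rcases i with _ | i
    · simpa [h0] using h
    · simpa using hnw i (by omega)
  · push_cast; omega

theorem chain_aux {A : Mat} {e : ℤ → Cell} {d : Cell → ℤ} (hd : IsChannelNumbering A e d)
    (ch : ℕ → Cell) (k : ℕ) (hs : ∀ i ≤ k, ch i ∈ supp A)
    (hnw : ∀ i < k, NW (ch (i + 1)) (ch i)) : d (ch k) + k ≤ d (ch 0) := by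
  induction k with
  | zero => simp
  | succ k ih =>
    have h1 := ih (fun i hi => hs i (by omega)) (fun i hi => hnw i (by omega))
    have h2 := step_aux hd (hs k (by omega)) (hs (k + 1) le_rfl) (hnw k (by omega))
    push_cast; omega

theorem tau_aux {m n : ℕ} {A : Mat} (hA : IsGAP m n A) {e : ℤ → Cell} {l : ℕ}
    (he : IsStreamEnum m n e l) {d : Cell → ℤ} (hd : IsChannelNumbering A e d)
    {c : Cell} (hc : c ∈ supp A) (hc' : tauC m n c ∈ supp A) :
    d (tauC m n c) ≤ d c + l := by
  obtain ⟨k, ch, h0, hs, hnw, idx, hidx, hv⟩ := (hd _ hc').1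
  have : d (tauC m n c) - l ≤ d c := by
    apply (hd c hc).2
    refine ⟨k, fun i => ((ch i).1 - m, (ch i).2 - n), ?_, ?_, ?_, idx - l, ?_, by omega⟩
    · simp [h0, tauC]
    · intro i hi
      have := hs i hi
      have h2 := hA.1 ((ch i).1 - m) ((ch i).2 - n)
      simp only [sub_add_cancel] at h2
      simp only [supp, Set.mem_ofPred_eq] at this ⊢
      rwa [← h2]
    · intro i hi
      have := hnw i hi
      simp only [NW] at this ⊢
      omega
    · have := he.2.2 (idx - l)
      rw [sub_add_cancel, hidx] at this
      simp only [← this]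
      simp [tauC]
  omega

theorem lin_ge {g : ℤ → ℤ} (h1 : ∀ i, g i + 1 ≤ g (i + 1)) (i : ℤ) (k : ℕ) :
    g i + k ≤ g (i + k) := by
  induction k with
  | zero => simp
  | succ k ih =>
    have := h1 (i + k)
    push_cast
    rw [← add_assoc i]
    omega

theorem lin_aux {g : ℤ → ℤ} {l : ℕ} (hl : 0 < l) (h1 : ∀ i, g i + 1 ≤ g (i + 1))
    (h2 : ∀ i, g (i + l) ≤ g i + l) (i j : ℤ) : g j - j = g i - i := by
  have key : ∀ i, g (i + 1) = g i + 1 := by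
    intro i
    have h3 := lin_ge h1 (i + 1) (l - 1)
    have h4 := h1 i
    have h5 := h2 i
    have : i + 1 + ((l - 1 : ℕ) : ℤ) = i + l := by omega
    rw [this] at h3
    omega
  have h0 : ∀ i, g i - i = g 0 - 0 := by
    intro i
    induction i using Int.induction_on with
    | zero => rfl
    | succ k ih => have := key k; omega
    | pred k ih =>
      have := key (-(k : ℤ) - 1)
      rw [sub_add_cancel] at this
      omega
  rw [h0 i, h0 j]

theorem self_aux {m n : ℕ} {A : Mat} (hA : IsGAP m n A) {e : ℤ → Cell} {l : ℕ}
    (he : IsStreamEnum m n e l) {d : Cell → ℤ} (hd : IsChannelNumbering A e d)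
    (hs : ∀ i, e i ∈ supp A) (i : ℤ) : d (e i) = i := by
  have hlin := lin_aux (g := fun i => d (e i)) he.1
    (fun i => step_aux hd (hs _) (hs _) (he.2.1 i))
    (fun i => by
      have := tau_aux hA he hd (hs i) (by rw [he.2.2]; exact hs _)
      rwa [he.2.2] at this)
  have h1 : i ≤ d (e i) := by
    apply (hd _ (hs i)).2
    exact ⟨0, fun _ => e i, rfl, fun _ _ => hs i, fun j hj => by omega, i, rfl, by simp⟩
  obtain ⟨k, ch, h0, hs', hnw, idx, hidx, hv⟩ := (hd _ (hs i)).1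
  have h2 := chain_aux hd ch k hs' hnw
  rw [h0, ← hidx] at h2
  have h3 := hlin i idx
  omega

theorem flow_le {m n : ℕ} {A : Mat} (hA : IsGAP m n A) {e e' : ℤ → Cell} {l l' : ℕ}
    (he : IsStreamEnum m n e l) (he' : IsStreamEnum m n e' l')
    {d : Cell → ℤ} (hd : IsChannelNumbering A e d)
    (hs' : ∀ i, e' i ∈ supp A) : l' ≤ l := by
  have h1 := lin_ge (g := fun i => d (e' i))
    (fun i => step_aux hd (hs' _) (hs' _) (he'.2.1 i)) 0 l'
  have h2 := tau_aux hA he hd (hs' 0) (by rw [he'.2.2]; exact hs' _)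
  rw [he'.2.2] at h2
  omega

theorem half_aux {m n : ℕ} {A : Mat} (hA : IsGAP m n A) {e e' : ℤ → Cell} {l : ℕ}
    (he : IsStreamEnum m n e l) (he' : IsStreamEnum m n e' l)
    {d d' : Cell → ℤ} (hd : IsChannelNumbering A e d) (hd' : IsChannelNumbering A e' d')
    (hs' : ∀ i, e' i ∈ supp A) (j : ℤ) (hj : d (e' j) = j) :
    ∀ c ∈ supp A, d' c ≤ d c := by
  intro c hc
  have hlin := lin_aux (g := fun i => d (e' i)) he.1
    (fun i => step_aux hd (hs' _) (hs' _) (he'.2.1 i))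
    (fun i => by
      have := tau_aux hA he hd (hs' i) (by rw [he'.2.2]; exact hs' _)
      rwa [he'.2.2] at this)
  obtain ⟨k, ch, h0, hs, hnw, idx, hidx, hv⟩ := (hd' c hc).1
  have h2 := chain_aux hd ch k hs hnw
  rw [h0, ← hidx] at h2
  have h3 := hlin j idx
  omega

/-- If `C₁`, `C₂` are channels of a nonzero `A ∈ M̂_{m×n}`
with `C₁ ∩ C₂ ≠ ∅` and the channel numberings `d₁ = d^{C₁}_A`, `d₂ = d^{C₂}_A`
agree on `C₁ ∩ C₂`, then `d₁ = d₂` on all of `supp A`. -/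
theorem channel_numberings_agree (m n : ℕ) (hm : 0 < m) (hn : 0 < n)
    (A : Mat) (hA : IsGAP m n A) (hA0 : A ≠ 0)
    (C₁ C₂ : Set Cell) (hC₁ : IsChannel m n A C₁) (hC₂ : IsChannel m n A C₂)
    (e₁ e₂ : ℤ → Cell) (l₁ l₂ : ℕ)
    (he₁ : IsStreamEnum m n e₁ l₁) (hr₁ : Set.range e₁ = C₁)
    (he₂ : IsStreamEnum m n e₂ l₂) (hr₂ : Set.range e₂ = C₂)
    (d₁ d₂ : Cell → ℤ)
    (hd₁ : IsChannelNumbering A e₁ d₁) (hd₂ : IsChannelNumbering A e₂ d₂)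
    (hne : (C₁ ∩ C₂).Nonempty) (hagree : ∀ c ∈ C₁ ∩ C₂, d₁ c = d₂ c) :
    ∀ c ∈ supp A, d₁ c = d₂ c := by
  have hs₁ : ∀ i, e₁ i ∈ supp A := by
    obtain ⟨l, -, h, -⟩ := hC₁
    intro i
    exact h (hr₁ ▸ Set.mem_range_self i)
  have hs₂ : ∀ i, e₂ i ∈ supp A := by
    obtain ⟨l, -, h, -⟩ := hC₂
    intro i
    exact h (hr₂ ▸ Set.mem_range_self i)
  have hl : l₁ = l₂ := le_antisymm (flow_le hA he₂ he₁ hd₂ hs₁) (flow_le hA he₁ he₂ hd₁ hs₂)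
  subst hl
  obtain ⟨c₀, hc₀⟩ := hne
  have hag := hagree c₀ hc₀
  obtain ⟨hm1, hm2⟩ := hc₀
  rw [← hr₁] at hm1
  rw [← hr₂] at hm2
  obtain ⟨i, hi⟩ := hm1
  obtain ⟨j, hj⟩ := hm2
  have h1 := self_aux hA he₁ hd₁ hs₁ i
  have h2 := self_aux hA he₂ hd₂ hs₂ j
  rw [hi] at h1
  rw [hj] at h2
  intro c hc
  apply le_antisymm
  · exact half_aux hA he₂ he₁ hd₂ hd₁ hs₁ i (by rw [hi]; omega) c hc
  · exact half_aux hA he₁ he₂ hd₁ hd₂ hs₂ j (by rw [hj]; omega) c hc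

end AffineRSK
end

section
/- For every nonzero A ∈ M̂_{m×n} with A^♭ ≠ O, the width of A^♭ is at most the width of A. Consequently, in the matrix-ball iteration A^(0) = A, A^(t) = (A^(t−1))^♭ terminating with A^(s−1) ≠ O and A^(s) = O, the flows μ₁, μ₂, …, μ_s of the streams s^(1), …, s^(s) form a weakly decreasing sequence of positive integers: μ₁ ≥ μ₂ ≥ ⋯ ≥ μ_s > 0. -/
open scoped Classical

namespace AffineRSK

/-! ### Helper lemmas for the proof -/

/-- Translation by `τ^q`. -/
def tq (m n : ℕ) (q : ℤ) (c : Cell) : Cell := (c.1 + q * (m : ℤ), c.2 + q * (n : ℤ))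

lemma tq_tq (m n : ℕ) (p q : ℤ) (c : Cell) : tq m n p (tq m n q c) = tq m n (p + q) c := by
  simp only [tq, Prod.mk.injEq]; constructor <;> ring

lemma tq_zero (m n : ℕ) (c : Cell) : tq m n 0 c = c := by simp [tq]

lemma tq_one (m n : ℕ) (c : Cell) : tq m n 1 c = tauC m n c := by simp [tq, tauC]

lemma tq_neg (m n : ℕ) (q : ℤ) (c : Cell) : tq m n (-q) (tq m n q c) = c := by
  rw [tq_tq]; simp [tq_zero]

lemma tq_neg' (m n : ℕ) (q : ℤ) (c : Cell) : tq m n q (tq m n (-q) c) = c := by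
  rw [tq_tq]; simp [tq_zero]

lemma int_step {P : ℤ → Prop} (h0 : P 0) (h : ∀ q, P q ↔ P (q + 1)) (q : ℤ) : P q := by
  induction q using Int.induction_on with
  | zero => exact h0
  | succ i ih => exact (h _).1 ih
  | pred i ih => exact (h _).2 (by simpa using ih)

lemma supp_tq {m n : ℕ} {A : Mat} (hA : IsGAP m n A) (q : ℤ) (c : Cell) :
    tq m n q c ∈ supp A ↔ c ∈ supp A := by
  refine int_step (P := fun q => tq m n q c ∈ supp A ↔ c ∈ supp A) (by simp [tq_zero]) ?_ q
  intro q
  have : tq m n (q + 1) c ∈ supp A ↔ tq m n q c ∈ supp A := by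
    have h := hA.1 (c.1 + q * m) (c.2 + q * n)
    have e : tq m n (q + 1) c = (c.1 + q * m + m, c.2 + q * n + n) := by
      simp only [tq, Prod.mk.injEq]; constructor <;> ring
    rw [e]; simp only [supp, Set.mem_ofPred_eq, h, tq]
  rw [this]

/-- `d` has period `l` on `supp A`. -/
def Per (m n : ℕ) (A : Mat) (d : Cell → ℤ) (l : ℕ) : Prop :=
  ∀ c ∈ supp A, d (tauC m n c) = d c + (l : ℤ)

lemma per_tq {m n : ℕ} {A : Mat} (hA : IsGAP m n A) {d : Cell → ℤ} {l : ℕ}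
    (hd : Per m n A d l) (q : ℤ) {c : Cell} (hc : c ∈ supp A) :
    d (tq m n q c) = d c + q * l := by
  refine int_step (P := fun q => d (tq m n q c) = d c + q * l) (by simp [tq_zero]) ?_ q
  intro q
  have h := hd (tq m n q c) ((supp_tq hA q c).2 hc)
  rw [← tq_one, tq_tq, add_comm 1 q] at h
  rw [h, add_mul, one_mul]
  constructor <;> intro h <;> linarith

/-- Finite set of orbit representatives. -/
lemma fin_reps {m n : ℕ} (hn : 0 < n) {A : Mat} (hA : IsGAP m n A) :
    ∃ F : Set Cell, F.Finite ∧ F ⊆ supp A ∧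
      ∀ c ∈ supp A, ∃ c0 ∈ F, ∃ q : ℤ, c = tq m n q c0 := by
  refine ⟨⋃ j ∈ Finset.Ico (0:ℤ) n, (fun i => ((i, j) : Cell)) '' {i : ℤ | A i j ≠ 0}, ?_, ?_, ?_⟩
  · refine Set.Finite.biUnion (Finset.finite_toSet _) ?_
    intro j _
    exact (hA.2 j).image _
  · intro c hc
    simp only [Set.mem_iUnion] at hc
    obtain ⟨j, _, i, hi, rfl⟩ := hc
    exact hi
  · intro c hc
    have hn' : (0:ℤ) < n := by exact_mod_cast hn
    refine ⟨tq m n (-(c.2 / n)) c, ?_, c.2 / n, (tq_neg' _ _ _ _).symm⟩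
    simp only [Set.mem_iUnion]
    have e : c.2 + -(c.2 / n) * n = c.2 % n := by
      have := Int.emod_add_mul_ediv c.2 n
      linarith
    refine ⟨c.2 % n, ?_, c.1 + -(c.2 / n) * m, ?_, ?_⟩
    · simp only [Finset.mem_Ico]
      exact ⟨Int.emod_nonneg _ hn'.ne', Int.emod_lt_of_pos _ hn'⟩
    · have := (supp_tq hA (-(c.2 / n)) c).2 hc
      simp only [tq, supp, Set.mem_ofPred_eq, e] at this
      exact this
    · simp only [tq, e]

/-- Strict monotonicity for `NW` on the support. -/
def Mono (A : Mat) (f : Cell → ℤ) : Prop :=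
  ∀ c₁ ∈ supp A, ∀ c₂ ∈ supp A, NW c₂ c₁ → f c₂ < f c₁

lemma comp_width {m n : ℕ} (hn : 0 < n) {B : Mat} (hB : IsGAP m n B) (hB0 : (supp B).Nonempty)
    {d f : Cell → ℤ} {l l' : ℕ} (hd : IsProper B d) (hdl : Per m n B d l)
    (hf : Mono B f) (hfl : Per m n B f l') : l ≤ l' := by
  obtain ⟨F, hF, hFs, hrep⟩ := fin_reps hn hB
  obtain ⟨x0, hx0⟩ := hB0
  choose! p hp using hd.2
  let c : ℕ → Cell := fun i => p^[i] x0
  have hcs : ∀ i, c (i + 1) = p (c i) := fun i => Function.iterate_succ_apply' p i x0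
  have hc : ∀ i, c i ∈ supp B := by
    intro i
    induction i with
    | zero => exact hx0
    | succ i ih => rw [hcs]; exact (hp _ ih).1
  have hdc : ∀ i k, d (c (i + k)) = d (c i) - (k : ℕ) := by
    intro i k
    induction k with
    | zero => simp
    | succ k ih =>
      rw [← add_assoc, hcs, (hp _ (hc _)).2.2, ih]; push_cast; ring
  have hfc : ∀ i k, f (c (i + k)) ≤ f (c i) - (k : ℕ) := by
    intro i k
    induction k with
    | zero => simp
    | succ k ih =>
      have h := hf (c (i + k)) (hc _) (c (i + k + 1)) (hc _) (by rw [hcs]; exact (hp _ (hc _)).2.1)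
      rw [← add_assoc]; push_cast; omega
  choose! r hr g hg using hrep
  obtain ⟨i, j, hij, he⟩ : ∃ i j, i < j ∧ r (c i) = r (c j) := by
    obtain ⟨i, -, j, -, hne, he⟩ := Set.infinite_univ.exists_ne_map_eq_of_mapsTo
      (f := fun i : ℕ => r (c i)) (t := F) (fun i _ => hr _ (hc i)) hF
    rcases lt_or_gt_of_ne hne with h | h
    · exact ⟨i, j, h, he⟩
    · exact ⟨j, i, h, he.symm⟩
  obtain ⟨k, rfl⟩ := Nat.exists_eq_add_of_lt hij
  have hdk := hdc i (k + 1)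
  have hfk := hfc i (k + 1)
  rw [← add_assoc] at hdk hfk
  have h0 := hFs (hr _ (hc i))
  have ei := hg _ (hc i)
  have ej := hg _ (hc (i + k + 1))
  rw [← he] at ej
  rw [ei, ej, per_tq hB hdl _ h0, per_tq hB hdl _ h0] at hdk
  rw [ei, ej, per_tq hB hfl _ h0, per_tq hB hfl _ h0] at hfk
  generalize g (c i) = a at *
  generalize g (c (i + k + 1)) = b at *
  push_cast at hdk hfk
  have h1 : (b - a) * (l : ℤ) = -(k + 1) := by linarith
  have h2 : (b - a) * (l' : ℤ) ≤ -(k + 1) := by linarith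
  have h3 : b - a < 0 := by
    by_contra hcon
    have : 0 ≤ (b - a) * (l : ℤ) := mul_nonneg (by omega) (by omega)
    omega
  by_contra hcon
  have : (l' : ℤ) < l := by omega
  nlinarith

/-- Properties of a southwest channel numbering. -/
lemma sw_proper {m n : ℕ} {A : Mat} (hA : IsGAP m n A) {d : Cell → ℤ}
    (h : IsSWNumbering m n A d) :
    (supp A).Nonempty ∧ IsProper A d ∧ ∃ l : ℕ, 0 < l ∧ Per m n A d l := by
  obtain ⟨e, ⟨⟨l, hl0, hnw, hper⟩, ⟨_, _, hsub, _⟩, _⟩, hd⟩ := h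
  have hes : ∀ i, e i ∈ supp A := fun i => hsub ⟨i, rfl⟩
  have hmono : ∀ c₁ ∈ supp A, ∀ c₂ ∈ supp A, NW c₂ c₁ → d c₂ < d c₁ := by
    intro c₁ h₁ c₂ h₂ hc
    obtain ⟨k, ch, h0, hs, hch, idx, hi, hv⟩ := (hd c₂ h₂).1
    have : d c₂ + 1 ∈ chainSet A e c₁ := by
      refine ⟨k + 1, fun i => if i = 0 then c₁ else ch (i - 1), by simp, ?_, ?_, idx, ?_, ?_⟩
      · intro i hi
        rcases i with _ | i
        · simpa using h₁
        · simpa using hs i (by omega)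
      · intro i hi
        rcases i with _ | i
        · simpa [h0] using hc
        · simpa using hch i (by omega)
      · simpa using hi
      · push_cast; omega
    have := (hd c₁ h₁).2 this
    omega
  have hidx : ∀ i, i ≤ d (e i) := by
    intro i
    exact (hd (e i) (hes i)).2 ⟨0, fun _ => e i, rfl, fun _ _ => hes i, by simp, i, rfl, by simp⟩
  have hshift : ∀ c ∈ supp A, ∀ q : ℤ, d c + q * l ≤ d (tq m n q c) := by
    intro c hc q
    obtain ⟨k, ch, h0, hs, hch, idx, hi, hv⟩ := (hd c hc).1
    have hq : ∀ i, e (i + q * l) = tq m n q (e i) := by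
      intro i
      refine int_step (P := fun q => e (i + q * l) = tq m n q (e i)) (by simp [tq_zero]) ?_ q
      intro q
      have h1 := hper (i + q * l)
      rw [← tq_one] at h1
      have e1 : i + (q + 1) * (l : ℤ) = i + q * l + l := by ring
      rw [e1, ← h1, add_comm q 1, ← tq_tq]
      constructor
      · intro h; rw [h]
      · intro h
        have := congrArg (tq m n (-1)) h
        rwa [tq_neg, tq_neg] at this
    refine (hd (tq m n q c) ((supp_tq hA q c).2 hc)).2 ⟨k, fun i => tq m n q (ch i), by simp [h0],
      fun i hi => (supp_tq hA q _).2 (hs i hi), ?_, idx + q * l, ?_, ?_⟩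
    · intro i hi
      have := hch i hi
      simp only [NW, tq] at this ⊢
      omega
    · rw [hq, hi]
    · rw [hv]; ring
  refine ⟨⟨e 0, hes 0⟩, ⟨hmono, ?_⟩, l, hl0, ?_⟩
  · intro c hc
    obtain ⟨k, ch, h0, hs, hch, idx, hi, hv⟩ := (hd c hc).1
    rcases k with _ | k
    · have hnw' : NW (e (idx - 1)) c := by
        have := hnw (idx - 1)
        rwa [sub_add_cancel, hi, h0] at this
      refine ⟨e (idx - 1), hes _, hnw', ?_⟩
      have h1 := hidx (idx - 1)
      have h2 := hmono c hc _ (hes _) hnw'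
      simp at hv
      omega
    · have hnw' : NW (ch 1) c := by
        have := hch 0 (by omega)
        rwa [h0] at this
      have hs1 := hs 1 (by omega)
      refine ⟨ch 1, hs1, hnw', ?_⟩
      have h2 := hmono c hc _ hs1 hnw'
      have h1 : d c - 1 ≤ d (ch 1) := by
        refine (hd _ hs1).2 ⟨k, fun i => ch (i + 1), rfl, fun i hi => hs _ (by omega),
          fun i hi => hch _ (by omega), idx, hi, ?_⟩
        push_cast at hv; omega
      omega
  · intro c hc
    have h1 := hshift c hc 1
    have h2 := hshift (tq m n 1 c) ((supp_tq hA 1 c).2 hc) (-1)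
    rw [tq_neg] at h2
    rw [← tq_one]
    linarith

lemma level_finite {m n : ℕ} (hn : 0 < n) {A : Mat} (hA : IsGAP m n A) {d : Cell → ℤ} {l : ℕ}
    (hl : 0 < l) (hd : Per m n A d l) (k : ℤ) : (levelSet A d k).Finite := by
  obtain ⟨F, hF, hFs, hrep⟩ := fin_reps hn hA
  refine (hF.image (fun c => tq m n ((k - d c) / l) c)).subset ?_
  rintro c ⟨hc, hk⟩
  obtain ⟨c0, h0, q, rfl⟩ := hrep c hc
  refine ⟨c0, h0, ?_⟩
  rw [per_tq hA hd q (hFs h0)] at hk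
  have : (k - d c0) / (l : ℤ) = q := by
    have e : k - d c0 = q * l := by omega
    rw [e]; exact Int.mul_ediv_cancel _ (by omega)
  simp only [this]

/-- Descend from a cell to a lower level. -/
lemma descend {A : Mat} {d : Cell → ℤ} (hd : IsProper A d) (j : ℕ) :
    ∀ c ∈ supp A, ∃ c' ∈ levelSet A d (d c - j), nwGe c' c ∧ (0 < j → NW c' c) := by
  induction j with
  | zero => intro c hc; exact ⟨c, ⟨hc, by simp⟩, ⟨le_refl _, le_refl _⟩, by simp⟩
  | succ j ih =>
    intro c hc
    obtain ⟨c1, hc1, hg, _⟩ := ih c hc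
    obtain ⟨c2, hc2, hn, h2⟩ := hd.2 c1 hc1.1
    have hN : NW c2 c := by
      simp only [NW, nwGe] at *; omega
    refine ⟨c2, ⟨hc2, ?_⟩, ⟨hN.1.le, hN.2.le⟩, fun _ => hN⟩
    rw [h2, hc1.2]; push_cast; ring

lemma level_nonempty {m n : ℕ} {A : Mat} (hA : IsGAP m n A) (hA0 : (supp A).Nonempty)
    {d : Cell → ℤ} {l : ℕ} (hp : IsProper A d)
    (hl : 0 < l) (hd : Per m n A d l) (k : ℤ) : (levelSet A d k).Nonempty := by
  obtain ⟨c, hc⟩ := hA0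
  have h1 : k ≤ d (tq m n |k - d c| c) := by
    rw [per_tq hA hd _ hc]
    have := le_abs_self (k - d c)
    have h3 : |k - d c| * 1 ≤ |k - d c| * (l : ℤ) :=
      mul_le_mul_of_nonneg_left (by omega) (abs_nonneg _)
    linarith
  obtain ⟨c', h', -⟩ := descend hp (d (tq m n |k - d c| c) - k).toNat _ ((supp_tq hA _ c).2 hc)
  rw [show d (tq m n |k - d c| c) - ((d (tq m n |k - d c| c) - k).toNat : ℤ) = k by omega] at h'
  exact ⟨c', h'⟩

lemma exists_max {S : Set Cell} (hS : S.Finite) {c : Cell} (hc : c ∈ S) :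
    ∃ y ∈ nwMaximal S, nwGe y c := by
  obtain ⟨y, ⟨hy, hyc⟩, hmin⟩ := Set.exists_min_image {y ∈ S | nwGe y c} (fun y => y.1 + y.2)
    (hS.subset (fun x hx => hx.1)) ⟨c, hc, le_refl _, le_refl _⟩
  refine ⟨y, ⟨hy, ?_⟩, hyc⟩
  intro w hw hwy
  have := hmin w ⟨hw, by simp only [nwGe] at *; omega⟩
  simp only [nwGe] at hwy this
  apply Prod.ext <;> omega

/-- Existence of a zig-zag with prescribed inner corners. -/
lemma exists_zigzag {M : Set Cell} (hf : M.Finite) (hne : M.Nonempty)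
    (hanti : ∀ c ∈ M, ∀ c' ∈ M, nwGe c' c → c' = c) :
    ∃ z, IsZigZag z ∧ innerCorners z = M := by
  have hR : ∀ t : ℤ, ∃ r : ℤ, (∃ c ∈ M, max c.1 (c.2 - t) = r) ∧ ∀ c ∈ M, r ≤ max c.1 (c.2 - t) := by
    intro t
    obtain ⟨c, hc, hmin⟩ := Set.exists_min_image M (fun c => max c.1 (c.2 - t)) hf hne
    exact ⟨_, ⟨c, hc, rfl⟩, hmin⟩
  choose R hR1 hR2 using hR
  have hstep : ∀ t, R (t + 1) = R t ∨ R (t + 1) = R t - 1 := by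
    intro t
    obtain ⟨c, hc, h1⟩ := hR1 t
    obtain ⟨c', hc', h1'⟩ := hR1 (t + 1)
    have h2 := hR2 t c' hc'
    have h3 := hR2 (t + 1) c hc
    omega
  obtain ⟨ca, hca, hamin⟩ := Set.exists_min_image M (fun c => c.1) hf hne
  obtain ⟨cb, hcb, hbmin⟩ := Set.exists_min_image M (fun c => c.2) hf hne
  have hright : ∀ t, ca.2 - ca.1 ≤ t → R t = ca.1 := by
    intro t ht
    obtain ⟨c, hc, h1⟩ := hR1 t
    have h2 := hR2 t ca hca
    have h3 := hamin c hc
    omega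
  have hleft : ∀ t, t ≤ cb.2 - cb.1 → R t = cb.2 - t := by
    intro t ht
    obtain ⟨c, hc, h1⟩ := hR1 t
    have h2 := hR2 t cb hcb
    have h3 := hbmin c hc
    omega
  refine ⟨fun t => (R t, R t + t), ⟨?_, ⟨ca.2 - ca.1, ?_⟩, ⟨cb.2 - cb.1 - 1, ?_⟩⟩, ?_⟩
  · intro t
    rcases hstep t with h | h
    · left; apply Prod.ext <;> dsimp only <;> omega
    · right; apply Prod.ext <;> dsimp only <;> omega
  · intro t ht
    have h1 := hright t ht
    have h2 := hright (t + 1) (by omega)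
    apply Prod.ext <;> dsimp only <;> omega
  · intro t ht
    have h1 := hleft t (by omega)
    have h2 := hleft (t + 1) (by omega)
    apply Prod.ext <;> dsimp only <;> omega
  · ext x
    simp only [innerCorners, Set.mem_ofPred_eq, Prod.mk.injEq]
    constructor
    · rintro ⟨t, rfl, h1, h2⟩
      obtain ⟨c, hc, h3⟩ := hR1 t
      have h4 := hR2 (t + 1) c hc
      have h5 := hR2 (t - 1) c hc
      have : c = (R t, R t + t) := by apply Prod.ext <;> simp only <;> omega
      rwa [← this]
    · intro hx
      have key : ∀ y ∈ M, y.1 ≤ x.1 → y.2 ≤ x.2 → y.1 = x.1 ∧ y.2 = x.2 := by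
        intro y hy h1 h2
        have := hanti x hx y hy ⟨h1, h2⟩
        rw [this]; exact ⟨rfl, rfl⟩
      have e0 : R (x.2 - x.1) = x.1 := by
        obtain ⟨c, hc, h1⟩ := hR1 (x.2 - x.1)
        have h2 := hR2 (x.2 - x.1) x hx
        have h3 := key c hc
        omega
      have e1 : R (x.2 - x.1 + 1) = x.1 := by
        obtain ⟨c, hc, h1⟩ := hR1 (x.2 - x.1 + 1)
        have h2 := hstep (x.2 - x.1)
        have h3 := key c hc
        omega
      have e2 : R (x.2 - x.1 - 1) = x.1 + 1 := by
        obtain ⟨c, hc, h1⟩ := hR1 (x.2 - x.1 - 1)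
        have h2 := hstep (x.2 - x.1 - 1)
        rw [sub_add_cancel] at h2
        have h3 := key c hc
        omega
      refine ⟨x.2 - x.1, ?_, ?_, ?_⟩
      · apply Prod.ext <;> simp only <;> omega
      · omega
      · omega

/-- Structure near an outer corner. -/
lemma outer_struct {z : ℤ → Cell} (hz : IsZigZag z) {c : Cell} (hc : c ∈ outerCorners z) :
    (∃ x ∈ innerCorners z, x.1 = c.1 ∧ x.2 < c.2) ∧ (∃ x ∈ innerCorners z, x.2 = c.2 ∧ x.1 < c.1) ∧
      ∀ x ∈ innerCorners z, ¬ NW x c := by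
  obtain ⟨hs, ⟨N, hN⟩, ⟨N', hN'⟩⟩ := hz
  obtain ⟨i, rfl, h1, h2⟩ := hc
  refine ⟨?_, ?_, ?_⟩
  · obtain ⟨p, ⟨hp1, hp2⟩, hmax⟩ := Int.exists_greatest_of_bdd
      (P := fun p => p ≤ i ∧ z p = ((z (p - 1)).1 - 1, (z (p - 1)).2))
      ⟨i, fun p hp => hp.1⟩ ⟨min N' i, by omega, by
        have := hN' (min N' i - 1) (by omega)
        rwa [sub_add_cancel] at this⟩
    have hpi : p ≠ i := by
      rintro rfl
      rw [hp2] at h1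
      simp at h1
    have heast : ∀ q, p < q → q ≤ i → z q = ((z (q - 1)).1, (z (q - 1)).2 + 1) := by
      intro q hq hqi
      rcases hs (q - 1) with h | h
      · rwa [sub_add_cancel] at h
      · rw [sub_add_cancel] at h
        have := hmax q ⟨hqi, h⟩
        omega
    have hpos : ∀ k : ℕ, p + k ≤ i → z (p + k) = ((z p).1, (z p).2 + k) := by
      intro k
      induction k with
      | zero => intro _; simp
      | succ k ih =>
        intro hk
        push_cast at hk ⊢
        have := heast (p + (k + 1)) (by omega) hk
        rw [this, show p + ((k:ℤ) + 1) - 1 = p + k by ring, ih (by omega)]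
        simp [add_assoc]
    have hk := hpos (i - p).toNat (by omega)
    rw [show p + ((i - p).toNat : ℤ) = i by omega] at hk
    refine ⟨z p, ⟨p, rfl, hp2, ?_⟩, ?_, ?_⟩
    · have := heast (p + 1) (by omega) (by omega)
      rwa [add_sub_cancel_right] at this
    · rw [hk]
    · rw [hk]; simp only; omega
  · obtain ⟨p, ⟨hp1, hp2⟩, hmin⟩ := Int.exists_least_of_bdd
      (P := fun p => i ≤ p ∧ z (p + 1) = ((z p).1, (z p).2 + 1))
      ⟨i, fun p hp => hp.1⟩ ⟨max N i, by omega, hN _ (by omega)⟩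
    have hpi : p ≠ i := by
      rintro rfl
      rw [hp2] at h2
      simp at h2
    have hnorth : ∀ q, i ≤ q → q < p → z (q + 1) = ((z q).1 - 1, (z q).2) := by
      intro q hq hqi
      rcases hs q with h | h
      · have := hmin q ⟨hq, h⟩
        omega
      · exact h
    have hpos : ∀ k : ℕ, i + k ≤ p → z (i + k) = ((z i).1 - k, (z i).2) := by
      intro k
      induction k with
      | zero => intro _; simp
      | succ k ih =>
        intro hk
        push_cast at hk ⊢
        have := hnorth (i + k) (by omega) (by omega)
        rw [← add_assoc, this, ih (by omega)]
        simp only [Prod.mk.injEq, and_true]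
        ring
    have hk := hpos (p - i).toNat (by omega)
    rw [show i + ((p - i).toNat : ℤ) = p by omega] at hk
    refine ⟨z p, ⟨p, rfl, ?_, hp2⟩, ?_, ?_⟩
    · have := hnorth (p - 1) (by omega) (by omega)
      rwa [sub_add_cancel] at this
    · rw [hk]
    · rw [hk]; simp only; omega
  · have hmono : ∀ (a : ℤ) (k : ℕ), (z (a + k)).1 ≤ (z a).1 ∧ (z a).2 ≤ (z (a + k)).2 := by
      intro a k
      induction k with
      | zero => simp
      | succ k ih =>
        push_cast
        rw [← add_assoc]
        rcases hs (a + k) with h | h <;> rw [h] <;> simp only <;> omega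
    rintro x ⟨j, rfl, -, -⟩ ⟨hx1, hx2⟩
    rcases le_total i j with h | h
    · have := hmono i (j - i).toNat
      rw [show i + ((j - i).toNat : ℤ) = j by omega] at this
      omega
    · have := hmono j (i - j).toNat
      rw [show j + ((i - j).toNat : ℤ) = i by omega] at this
      omega

/-- Outer corner at level `k`. -/
lemma outer_level {A : Mat} {d : Cell → ℤ} (hp : IsProper A d)
    (hfin : ∀ k, (levelSet A d k).Finite) {k : ℤ} {z : ℤ → Cell} (hz : ZigZagAt A d k z)
    {c : Cell} (hc : c ∈ outerCorners z) :
    (∃ x ∈ levelSet A d k, x.1 = c.1 ∧ x.2 < c.2) ∧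
    (∃ x ∈ levelSet A d k, x.2 = c.2 ∧ x.1 < c.1) ∧
      ∀ x ∈ supp A, NW x c → d x < k := by
  obtain ⟨⟨x, hx, h1⟩, ⟨y, hy, h2⟩, h3⟩ := outer_struct hz.1 hc
  rw [hz.2] at hx hy h3
  refine ⟨⟨x, hx.1, h1⟩, ⟨y, hy.1, h2⟩, ?_⟩
  intro w hw hwc
  by_contra hcon
  obtain ⟨w', hw', hg, -⟩ := descend hp (d w - k).toNat w hw
  rw [show d w - ((d w - k).toNat : ℤ) = k by omega] at hw'
  obtain ⟨v, hv, hvw⟩ := exists_max (hfin k) hw'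
  apply h3 v hv
  simp only [NW, nwGe] at *
  omega

lemma outer_unique {A : Mat} {d : Cell → ℤ} (hp : IsProper A d)
    (hfin : ∀ k, (levelSet A d k).Finite) {k k' : ℤ} {z z' : ℤ → Cell} (hz : ZigZagAt A d k z)
    (hz' : ZigZagAt A d k' z')
    {c : Cell} (hc : c ∈ outerCorners z) (hc' : c ∈ outerCorners z') : k' ≤ k := by
  by_contra hcon
  obtain ⟨⟨x, hx, h1⟩, -, -⟩ := outer_level hp hfin hz' hc'
  obtain ⟨-, -, h3⟩ := outer_level hp hfin hz hc
  obtain ⟨y, hy, -, hn⟩ := descend hp (k' - k).toNat x hx.1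
  have := h3 y hy.1 (by have := hn (by omega); simp only [NW] at *; omega)
  have e1 := hy.2
  have e2 := hx.2
  omega

/-- Translating zig-zags. -/
lemma zigzag_shift {m n : ℕ} {A : Mat} (hA : IsGAP m n A) {d : Cell → ℤ} {l : ℕ}
    (hd : Per m n A d l) {k : ℤ} {z : ℤ → Cell} (hz : ZigZagAt A d k z) (q : ℤ) :
    ZigZagAt A d (k + q * l) (fun i => tq m n q (z i)) := by
  have hN : ∀ a b : Cell, b = (a.1 - 1, a.2) ↔ tq m n q b = ((tq m n q a).1 - 1, (tq m n q a).2) := by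
    intro a b
    simp only [tq, Prod.ext_iff]; omega
  have hE : ∀ a b : Cell, b = (a.1, a.2 + 1) ↔ tq m n q b = ((tq m n q a).1, (tq m n q a).2 + 1) := by
    intro a b
    simp only [tq, Prod.ext_iff]; omega
  have hlev : ∀ c, c ∈ levelSet A d (k + q * l) ↔ tq m n (-q) c ∈ levelSet A d k := by
    intro c
    constructor
    · rintro ⟨h1, h2⟩
      refine ⟨(supp_tq hA _ _).2 h1, ?_⟩
      rw [per_tq hA hd _ h1, h2]; ring
    · rintro ⟨h1, h2⟩
      have h1' := (supp_tq hA _ _).1 h1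
      refine ⟨h1', ?_⟩
      rw [per_tq hA hd _ h1'] at h2
      linarith
  have hnw : ∀ a b : Cell, ∀ p, nwGe (tq m n p a) (tq m n p b) ↔ nwGe a b := by
    intro a b p; simp only [nwGe, tq]; omega
  obtain ⟨⟨h1, ⟨N, h2⟩, ⟨N', h3⟩⟩, h4⟩ := hz
  refine ⟨⟨fun i => ?_, ⟨N, fun i hi => (hE _ _).1 (h2 i hi)⟩,
    ⟨N', fun i hi => (hN _ _).1 (h3 i hi)⟩⟩, ?_⟩
  · rcases h1 i with h | h
    · exact Or.inl ((hE _ _).1 h)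
    · exact Or.inr ((hN _ _).1 h)
  · ext x
    have e1 : x ∈ innerCorners (fun i => tq m n q (z i)) ↔ tq m n (-q) x ∈ innerCorners z := by
      constructor
      · rintro ⟨i, rfl, ha, hb⟩
        exact ⟨i, (tq_neg _ _ _ _).symm, (hN _ _).2 ha, (hE _ _).2 hb⟩
      · rintro ⟨i, hi, ha, hb⟩
        refine ⟨i, ?_, (hN _ _).1 ha, (hE _ _).1 hb⟩
        simp only [hi, tq_neg']
    rw [e1, h4]
    constructor
    · rintro ⟨ha, hb⟩
      refine ⟨(hlev _).2 ha, ?_⟩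
      intro y hy hyx
      have := hb _ ((hlev _).1 hy) ((hnw _ _ _).2 hyx)
      have := congrArg (tq m n q) this
      rwa [tq_neg', tq_neg'] at this
    · rintro ⟨ha, hb⟩
      refine ⟨(hlev _).1 ha, ?_⟩
      intro y hy hyx
      have := hb (tq m n q y) ((hlev _).2 (by rwa [tq_neg]))
        (by rw [← hnw _ _ (-q), tq_neg]; exact hyx)
      rw [← this, tq_neg]

lemma inner_tq {m n : ℕ} (q : ℤ) {z : ℤ → Cell} {c : Cell} (hc : c ∈ innerCorners z) :
    tq m n q c ∈ innerCorners (fun i => tq m n q (z i)) := by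
  obtain ⟨i, rfl, ha, hb⟩ := hc
  refine ⟨i, rfl, ?_, ?_⟩
  · simp only [tq, Prod.ext_iff] at *; omega
  · simp only [tq, Prod.ext_iff] at *; omega

lemma outer_tq {m n : ℕ} (q : ℤ) {z : ℤ → Cell} {c : Cell} (hc : c ∈ outerCorners z) :
    tq m n q c ∈ outerCorners (fun i => tq m n q (z i)) := by
  obtain ⟨i, rfl, ha, hb⟩ := hc
  refine ⟨i, rfl, ?_, ?_⟩
  · simp only [tq, Prod.ext_iff] at *; omega
  · simp only [tq, Prod.ext_iff] at *; omega

lemma flat_supp {A B : Mat} {d : Cell → ℤ}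
    (hB : FlatEntries A B (IsInnerOf A d) (IsOuterOf A d)) {c : Cell} (hc : c ∈ supp B) :
    c ∈ supp A ∨ IsOuterOf A d c := by
  by_cases ho : IsOuterOf A d c
  · exact Or.inr ho
  · left
    obtain ⟨h1, -, h3⟩ := hB c
    simp only [supp, Set.mem_ofPred_eq] at hc ⊢
    by_cases hi : IsInnerOf A d c
    · have := h1 hi; omega
    · have := h3 hi ho; omega

lemma flat_gap {m n : ℕ} (hn : 0 < n) {A B : Mat} (hA : IsGAP m n A) (h : FlatRel m n A B) :
    IsGAP m n B := by
  obtain ⟨d, hd, hB⟩ := h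
  obtain ⟨hne, hp, l, hl, hper⟩ := sw_proper hA hd
  have hfin := level_finite hn hA hl hper
  have hI : ∀ q c, IsInnerOf A d c → IsInnerOf A d (tq m n q c) := by
    rintro q c ⟨k, z, hz, hc⟩
    exact ⟨_, _, zigzag_shift hA hper hz q, inner_tq q hc⟩
  have hO : ∀ q c, IsOuterOf A d c → IsOuterOf A d (tq m n q c) := by
    rintro q c ⟨k, z, hz, hc⟩
    exact ⟨_, _, zigzag_shift hA hper hz q, outer_tq q hc⟩
  constructor
  · intro i j
    have hI1 := hI 1 (i, j)
    have hO1 := hO 1 (i, j)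
    have hI2 := hI (-1) (tq m n 1 (i, j))
    have hO2 := hO (-1) (tq m n 1 (i, j))
    rw [tq_neg] at hI2 hO2
    obtain ⟨a1, a2, a3⟩ := hB (i, j)
    obtain ⟨b1, b2, b3⟩ := hB (tq m n 1 (i, j))
    have hAA := hA.1 i j
    simp only [tq, one_mul] at *
    by_cases x : IsInnerOf A d (i, j)
    · have := a1 x
      have := b1 (hI1 x)
      omega
    · by_cases y : IsOuterOf A d (i, j)
      · have := a2 y
        have := b2 (hO1 y)
        omega
      · have := a3 x y
        have := b3 (fun h => x (hI2 h)) (fun h => y (hO2 h))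
        omega
  · intro j
    refine ((hA.2 j).union ((hA.2 j).biUnion
      (t := fun i1 => Prod.fst '' levelSet A d (d (i1, j))) (fun i1 _ => (hfin _).image _))).subset ?_
    intro i hi
    rcases flat_supp hB (c := (i, j)) hi with h | ⟨k, z, hz, hc⟩
    · exact Or.inl h
    · right
      obtain ⟨⟨x, hx, hx1, -⟩, ⟨y, hy, hy1, -⟩, -⟩ := outer_level hp hfin hz hc
      simp only at hx1 hy1
      subst hx1 hy1
      simp only [Set.mem_iUnion]
      exact ⟨y.1, hy.1, x, by rw [hy.2]; exact hx, rfl⟩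

/-- The widths decrease, internal version. -/
lemma flat_width {m n : ℕ} (hn : 0 < n) {A B : Mat} (hA : IsGAP m n A) (h : FlatRel m n A B)
    (hB0 : (supp B).Nonempty) {dA dB : Cell → ℤ} {lA lB : ℕ}
    (hpA : IsProper A dA) (hlA : Per m n A dA lA) (hpB : IsProper B dB) (hlB : Per m n B dB lB) :
    lB ≤ lA := by
  have hBG := flat_gap hn hA h
  obtain ⟨d, hd, hB⟩ := h
  obtain ⟨hne, hp, l, hl, hper⟩ := sw_proper hA hd
  have hfin := level_finite hn hA hl hper
  refine le_trans ?_ (comp_width hn hA hne hp hper hpA.1 hlA)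
  have hF : ∀ c, ∃ v : ℤ, (c ∈ supp A → v = d c) ∧
      (c ∉ supp A → IsOuterOf A d c → ∃ z, ZigZagAt A d v z ∧ c ∈ outerCorners z) := by
    intro c
    by_cases hc : c ∈ supp A
    · exact ⟨d c, fun _ => rfl, fun h => absurd hc h⟩
    · by_cases ho : IsOuterOf A d c
      · obtain ⟨k, z, hz⟩ := ho
        exact ⟨k, fun h => absurd h hc, fun _ _ => ⟨z, hz⟩⟩
      · exact ⟨0, fun h => absurd h hc, fun _ h => absurd h ho⟩
  choose f hf1 hf2 using hF
  have hcase : ∀ c ∈ supp B, (c ∈ supp A ∧ f c = d c) ∨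
      (c ∉ supp A ∧ ∃ z, ZigZagAt A d (f c) z ∧ c ∈ outerCorners z) := by
    intro c hc
    by_cases hcA : c ∈ supp A
    · exact Or.inl ⟨hcA, hf1 c hcA⟩
    · exact Or.inr ⟨hcA, hf2 c hcA ((flat_supp hB hc).resolve_left hcA)⟩
  refine comp_width hn hBG hB0 hpB hlB (f := f) ?_ ?_
  · intro c₁ h₁ c₂ h₂ hnw
    -- a cell of level `f c₂` of `A` lying strictly NW of `c₁`
    obtain ⟨x, hx, hxn⟩ : ∃ x ∈ levelSet A d (f c₂), NW x c₁ := by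
      rcases hcase c₂ h₂ with ⟨ha, hb⟩ | ⟨-, z, hz, hc⟩
      · exact ⟨c₂, ⟨ha, hb.symm⟩, hnw⟩
      · obtain ⟨⟨x, hx, h1, h2⟩, -, -⟩ := outer_level hp hfin hz hc
        exact ⟨x, hx, by simp only [NW] at *; omega⟩
    rw [← hx.2]
    rcases hcase c₁ h₁ with ⟨ha, hb⟩ | ⟨-, z, hz, hc⟩
    · rw [hb]; exact hp.1 _ ha _ hx.1 hxn
    · exact (outer_level hp hfin hz hc).2.2 x hx.1 hxn
  · intro c hc
    have hc' : tq m n 1 c ∈ supp B := (supp_tq hBG 1 c).2 hc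
    rw [← tq_one]
    rcases hcase c hc with ⟨ha, hb⟩ | ⟨hna, z, hz, ho⟩
    · rw [hf1 _ ((supp_tq hA 1 c).2 ha), hb, per_tq hA hper 1 ha, one_mul]
    · rcases hcase _ hc' with ⟨ha, hb⟩ | ⟨hna', z', hz', ho'⟩
      · exact absurd ((supp_tq hA 1 c).1 ha) hna
      · have hs := zigzag_shift hA hper hz 1
        have ho1 := outer_tq (m := m) (n := n) 1 ho
        have h1 := outer_unique hp hfin hz' hs ho' ho1
        have h2 := outer_unique hp hfin hs hz' ho1 ho'
        rw [one_mul] at h1 h2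
        omega

lemma nw_lt {e : ℤ → Cell} (h : ∀ i, NW (e i) (e (i + 1))) : StrictMono (fun i => (e i).1) :=
  strictMono_int_of_lt_succ (fun i => (h i).1)

lemma flow_le_s13 {m n : ℕ} {e b : ℤ → Cell} {l l' : ℕ} (he : IsStreamEnum m n e l)
    (hb : IsStreamEnum m n b l') (hsub : Set.range e ⊆ Set.range b) : l ≤ l' := by
  have : ∀ i, ∃ j, b j = e i := fun i => hsub ⟨i, rfl⟩
  choose g hg using this
  have me := nw_lt he.2.1
  have mb := nw_lt hb.2.1
  have hgm : StrictMono g := by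
    intro i j hij
    have := me hij
    simp only [← hg] at this
    exact mb.lt_iff_lt.1 this
  have h1 : g (0 + l) = g 0 + l' := by
    apply mb.injective
    simp only
    rw [hg, ← he.2.2, ← hb.2.2, hg]
  have h2 : ∀ k : ℕ, g 0 + k ≤ g (0 + k) := by
    intro k
    induction k with
    | zero => simp
    | succ k ih =>
      have := hgm (show (0 + (k:ℤ)) < 0 + ((k + 1 : ℕ) : ℤ) by push_cast; omega)
      push_cast at *
      omega
  have := h2 l
  omega

lemma backpost_least {A : Mat} {d : Cell → ℤ} (hfin : ∀ k, (levelSet A d k).Finite) {k : ℤ}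
    {z : ℤ → Cell} (hz : ZigZagAt A d k z) {c : Cell} (hc : IsBackPost z c) :
    (∃ x ∈ levelSet A d k, x.1 = c.1) ∧ (∃ x ∈ levelSet A d k, x.2 = c.2) ∧
      ∀ x ∈ levelSet A d k, nwGe c x := by
  obtain ⟨cr, hcr, cl, hcl, h1, h2, rfl⟩ := hc
  rw [hz.2] at hcr hcl h1 h2
  refine ⟨⟨cr, hcr.1, rfl⟩, ⟨cl, hcl.1, rfl⟩, ?_⟩
  intro x hx
  obtain ⟨y, hy, hyx⟩ := exists_max (hfin k) hx
  have a := h1 y hy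
  have b := h2 y hy
  refine ⟨?_, le_trans b hyx.2⟩
  refine le_trans ?_ hyx.1
  by_contra hcon
  have := hcr.2 y hy.1 ⟨by simp only at hcon ⊢; omega, a⟩
  rw [this] at hcon
  simp at hcon

lemma backpost_flow {m n : ℕ} (hn : 0 < n) {A : Mat} (hA : IsGAP m n A) {d : Cell → ℤ}
    {e : ℤ → Cell} {μ : ℕ} (hd : IsSWNumbering m n A d) (he : IsStreamEnum m n e μ)
    (hr : Set.range e = backPostSet A d) :
    (supp A).Nonempty ∧ IsProper A d ∧ Per m n A d μ := by
  obtain ⟨hne, hp, l, hl, hper⟩ := sw_proper hA hd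
  have hfin := level_finite hn hA hl hper
  have hnon := level_nonempty hA hne hp hl hper
  have hex : ∀ k, ∃ (z : ℤ → Cell) (c : Cell), ZigZagAt A d k z ∧ IsBackPost z c := by
    intro k
    have hMf : (nwMaximal (levelSet A d k)).Finite := (hfin k).subset (fun x hx => hx.1)
    have hMn : (nwMaximal (levelSet A d k)).Nonempty := by
      obtain ⟨x, hx⟩ := hnon k
      obtain ⟨y, hy, -⟩ := exists_max (hfin k) hx
      exact ⟨y, hy⟩
    obtain ⟨z, hz, hzi⟩ := exists_zigzag hMf hMn (fun c hc c' hc' h => hc.2 c' hc'.1 h)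
    obtain ⟨cr, hcr, h1⟩ := Set.exists_max_image _ (fun c : Cell => c.2) hMf hMn
    obtain ⟨cl, hcl, h2⟩ := Set.exists_min_image _ (fun c : Cell => c.2) hMf hMn
    rw [← hzi] at hcr hcl h1 h2
    exact ⟨z, (cr.1, cl.2), ⟨hz, hzi⟩, cr, hcr, cl, hcl, h1, h2, rfl⟩
  choose Z b hZ hb using hex
  have huniq : ∀ k (c : Cell), (∃ x ∈ levelSet A d k, x.1 = c.1) →
      (∃ x ∈ levelSet A d k, x.2 = c.2) → (∀ x ∈ levelSet A d k, nwGe c x) → c = b k := by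
    rintro k c ⟨x, hx, hx1⟩ ⟨y, hy, hy1⟩ h
    obtain ⟨⟨x', hx', hx1'⟩, ⟨y', hy', hy1'⟩, h'⟩ := backpost_least hfin (hZ k) (hb k)
    have a1 := h x' hx'
    have a2 := h y' hy'
    have a3 := h' x hx
    have a4 := h' y hy
    simp only [nwGe] at *
    apply Prod.ext <;> omega
  have hrange : Set.range b = backPostSet A d := by
    ext c
    constructor
    · rintro ⟨k, rfl⟩
      exact ⟨k, Z k, hZ k, hb k⟩
    · rintro ⟨k, z, hz, hc⟩
      obtain ⟨a1, a2, a3⟩ := backpost_least hfin hz hc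
      exact ⟨k, (huniq k c a1 a2 a3).symm⟩
  have hbs : IsStreamEnum m n b l := by
    refine ⟨hl, ?_, ?_⟩
    · intro k
      obtain ⟨⟨x, hx, hx1⟩, ⟨y, hy, hy1⟩, -⟩ := backpost_least hfin (hZ (k + 1)) (hb (k + 1))
      obtain ⟨-, -, h⟩ := backpost_least hfin (hZ k) (hb k)
      obtain ⟨x', hx', hxn, hxd⟩ := hp.2 x hx.1
      obtain ⟨y', hy', hyn, hyd⟩ := hp.2 y hy.1
      have a1 := h x' ⟨hx', by rw [hxd, hx.2]; ring⟩
      have a2 := h y' ⟨hy', by rw [hyd, hy.2]; ring⟩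
      simp only [NW, nwGe] at *
      omega
    · intro k
      obtain ⟨⟨x, hx, hx1⟩, ⟨y, hy, hy1⟩, h⟩ := backpost_least hfin (hZ k) (hb k)
      have hsh : ∀ w ∈ levelSet A d k, tq m n 1 w ∈ levelSet A d (k + l) := by
        intro w hw
        refine ⟨(supp_tq hA 1 w).2 hw.1, ?_⟩
        rw [per_tq hA hper 1 hw.1, hw.2, one_mul]
      refine huniq _ _ ⟨_, hsh x hx, ?_⟩ ⟨_, hsh y hy, ?_⟩ ?_
      · simp [tq, tauC, hx1]
      · simp [tq, tauC, hy1]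
      · intro w hw
        have := h (tq m n (-1) w) ⟨(supp_tq hA _ w).2 hw.1, by
          rw [per_tq hA hper _ hw.1, hw.2]; ring⟩
        simp only [nwGe, tq, tauC] at *
        omega
  have hμ : μ = l := le_antisymm (flow_le_s13 he hbs (by rw [hr, hrange]))
    (flow_le_s13 hbs he (by rw [hr, hrange]))
  exact ⟨hne, hp, hμ ▸ hper⟩

lemma supp_nonempty {A : Mat} (h : A ≠ 0) : (supp A).Nonempty := by
  by_contra hcon
  apply h
  funext i j
  by_contra h'
  exact hcon ⟨(i, j), h'⟩

/-- The width of `A^♭` is at most the width of `A`;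
consequently, in the matrix-ball iteration the flows `μ₁, …, μ_s` of the
streams `s^(1), …, s^(s)` form a weakly decreasing sequence of positive
integers. -/
theorem width_weakly_decreasing (m n : ℕ) (hm : 0 < m) (hn : 0 < n) :
    (∀ A B : Mat, IsGAP m n A → A ≠ 0 → FlatRel m n A B → B ≠ 0 →
      ∀ lA lB : ℕ, HasWidth m n A lA → HasWidth m n B lB → lB ≤ lA) ∧
    ∀ (A : Mat) (s : ℕ) (μ : ℕ → ℕ) (P Q : ℕ → ℕ → ℤ) (ρ : ℕ → ℤ),
      IsGAP m n A → Kappa0Rel m n A s μ P Q ρ →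
        (∀ t : ℕ, t + 1 < s → μ (t + 1) ≤ μ t) ∧ ∀ t < s, 0 < μ t := by
  refine ⟨?_, ?_⟩
  · rintro A B hA - hF hB lA lB ⟨dA, hpA, hlA⟩ ⟨dB, hpB, hlB⟩
    exact flat_width hn hA hF (supp_nonempty hB) hpA hlA hpB hlB
  · rintro A s μ P Q ρ hA ⟨S, ⟨h0, hne, hs, hstep⟩, hK⟩
    have hG : ∀ t, t ≤ s → IsGAP m n (S t) := by
      intro t
      induction t with
      | zero => intro _; rw [h0]; exact hA
      | succ t ih => intro ht; exact flat_gap hn (ih (by omega)) (hstep t (by omega))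
    refine ⟨?_, ?_⟩
    · intro t ht
      obtain ⟨d, e, hd, he, hr, -⟩ := hK t (by omega)
      obtain ⟨d', e', hd', he', hr', -⟩ := hK (t + 1) ht
      obtain ⟨-, hp, hper⟩ := backpost_flow hn (hG t (by omega)) hd he hr
      obtain ⟨hne', hp', hper'⟩ := backpost_flow hn (hG (t + 1) (by omega)) hd' he' hr'
      exact flat_width hn (hG t (by omega)) (hstep t (by omega)) hne' hp hper hp' hper'
    · intro t ht
      obtain ⟨d, e, hd, he, -⟩ := hK t ht
      exact he.1

end AffineRSK
end

section
/- For a rectangle R = (a^b) with a ≥ 1 and 1 ≤ b ≤ n, the map (T, ν) ↦ τ_n^{ν_rev}(T), where T = (T^a,…,T^1) ∈ B_n(R)₀, ν = (ν₁,…,ν_{a−1}) ∈ 𝒫_{a−1}, and ν_rev = (0, ν_{a−1},…,ν₂,ν₁), is a bijection from B_n(R)₀ × 𝒫_{a−1} onto B_n(R). -/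
open scoped Classical

namespace AffineRSK

section helpers

theorem ext_nat (n b : ℕ) (c : ℕ → ℤ) (x : ℕ) (hx : x < b) : colExt n b c (x : ℤ) = c x := by
  have h1 : Int.emod (x : ℤ) (b : ℤ) = x := Int.emod_eq_of_lt (by omega) (by omega)
  have h2 : Int.ediv (x : ℤ) (b : ℤ) = 0 := Int.ediv_eq_zero_of_lt (by omega) (by omega)
  simp [colExt, h1, h2]

theorem ext_period (n b : ℕ) (hb : 1 ≤ b) (c : ℕ → ℤ) (z q : ℤ) :
    colExt n b c (z + b * q) = colExt n b c z + n * q := by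
  have h1 : Int.emod (z + b * q) (b : ℤ) = Int.emod z b := Int.add_mul_emod_self_left z b q
  have h2 : Int.ediv (z + b * q) (b : ℤ) = Int.ediv z b + q :=
    Int.add_mul_ediv_left z q (by omega)
  simp only [colExt, h1, h2]
  ring

theorem int_decomp (b : ℕ) (hb : 1 ≤ b) (z : ℤ) : ∃ (x : ℕ) (q : ℤ), x < b ∧ z = x + b * q := by
  refine ⟨(z % (b : ℤ)).toNat, z / (b : ℤ), ?_, ?_⟩
  · have := Int.emod_nonneg z (b := (b : ℤ)) (by omega)
    have := Int.emod_lt_of_pos z (b := (b : ℤ)) (by omega)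
    omega
  · have := Int.emod_nonneg z (b := (b : ℤ)) (by omega)
    rw [Int.toNat_of_nonneg this]
    exact (Int.emod_add_mul_ediv z b).symm

theorem ext_eq (n b : ℕ) (hb : 1 ≤ b) (c : ℕ → ℤ) (x : ℕ) (q : ℤ) (hx : x < b) :
    colExt n b c (x + b * q) = c x + n * q := by
  rw [ext_period n b hb, ext_nat n b c x hx]

theorem ext_strictMono (n b : ℕ) (hb : 1 ≤ b) (c : ℕ → ℤ) :
    StrictMono (colExt n b c) ↔
      ((∀ x : ℕ, x + 1 < b → c x < c (x + 1)) ∧ c (b - 1) - c 0 < (n : ℤ)) := by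
  constructor
  · intro h
    refine ⟨fun x hx => ?_, ?_⟩
    · have := h (show (x : ℤ) < ((x + 1 : ℕ) : ℤ) by omega)
      rwa [ext_nat n b c x (by omega), ext_nat n b c _ hx] at this
    · have := h (show ((b - 1 : ℕ) : ℤ) < ((0 : ℕ) : ℤ) + b * 1 by omega)
      rw [ext_nat n b c _ (by omega), ext_eq n b hb c 0 1 (by omega)] at this
      linarith
  · rintro ⟨h1, h2⟩
    refine strictMono_int_of_lt_succ fun z => ?_
    obtain ⟨x, q, hx, rfl⟩ := int_decomp b hb z
    rw [ext_eq n b hb c x q hx]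
    by_cases hx' : x + 1 < b
    · have e : (x : ℤ) + b * q + 1 = ((x + 1 : ℕ) : ℤ) + b * q := by push_cast; ring
      rw [e, ext_eq n b hb c (x + 1) q hx']
      have := h1 x hx'
      linarith
    · have hxb : x = b - 1 := by omega
      have e : (x : ℤ) + b * q + 1 = ((0 : ℕ) : ℤ) + b * (q + 1) := by
        have : (x : ℤ) = b - 1 := by omega
        rw [this]; push_cast; ring
      rw [e, ext_eq n b hb c 0 (q + 1) (by omega), hxb]
      linarith

theorem ext_shift (n b : ℕ) (hb : 1 ≤ b) (c d : ℕ → ℤ) (k : ℤ)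
    (h : ∀ x < b, c x = tauPow n b k d x) (z : ℤ) :
    colExt n b c z = colExt n b d (z + k) := by
  obtain ⟨x, q, hx, rfl⟩ := int_decomp b hb z
  rw [ext_eq n b hb c x q hx, h x hx, show (x : ℤ) + b * q + k = x + k + b * q by ring,
    ext_period n b hb]
  rfl

theorem ext_le (n b : ℕ) (hb : 1 ≤ b) (c d : ℕ → ℤ) (k : ℤ) :
    (∀ x < b, c x ≤ tauPow n b k d x) ↔ ∀ z : ℤ, colExt n b c z ≤ colExt n b d (z + k) := by
  constructor
  · intro h z
    obtain ⟨x, q, hx, rfl⟩ := int_decomp b hb z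
    rw [ext_eq n b hb c x q hx, show (x : ℤ) + b * q + k = x + k + b * q by ring,
      ext_period n b hb]
    have := h x hx
    unfold tauPow at this
    linarith
  · intro h x hx
    have := h x
    rwa [ext_nat n b c x hx] at this

theorem ext_le0 (n b : ℕ) (hb : 1 ≤ b) (c d : ℕ → ℤ) :
    (∀ x < b, c x ≤ d x) ↔ ∀ z : ℤ, colExt n b c z ≤ colExt n b d z := by
  have := ext_le n b hb c d 0
  simp only [add_zero] at this
  rw [← this]
  refine forall₂_congr fun x hx => ?_
  simp only [tauPow, add_zero]
  rw [ext_nat n b d x hx]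

theorem inBnR_iff (n a b : ℕ) (hb : 1 ≤ b) (T : ℕ → ℕ → ℤ) :
    InBnR n a b T ↔
      (∀ j : ℕ, j + 1 < a → ∀ z, colExt n b (T (j + 1)) z ≤ colExt n b (T j) z) ∧
      (∀ j < a, StrictMono (colExt n b (T j))) ∧
      ∀ j x : ℕ, a ≤ j ∨ b ≤ x → T j x = 0 := by
  unfold InBnR
  simp only [ext_strictMono n b hb, ← ext_le0 n b hb]
  constructor
  · rintro ⟨h1, h2, h3, h4⟩
    exact ⟨h1, fun j hj => ⟨h2 j hj, h3 j hj⟩, h4⟩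
  · rintro ⟨h1, h2, h4⟩
    exact ⟨h1, fun j hj => (h2 j hj).1, fun j hj => (h2 j hj).2, h4⟩

theorem inBnR0_iff (n a b : ℕ) (hb : 1 ≤ b) (T : ℕ → ℕ → ℤ) :
    InBnR0 n a b T ↔ InBnR n a b T ∧
      ∀ j : ℕ, j + 1 < a → ¬ ∀ z, colExt n b (T (j + 1)) z ≤ colExt n b (T j) (z + (-1)) := by
  unfold InBnR0
  simp only [ext_le n b hb]

theorem phi_ext (n a b : ℕ) (hb : 1 ≤ b) (T : ℕ → ℕ → ℤ) (ν : ℕ → ℕ) (j : ℕ) (hj : j < a)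
    (z : ℤ) : colExt n b (PhiMap n a b T ν j) z = colExt n b (T j) (z + ν (j + 1)) := by
  refine ext_shift n b hb _ _ _ (fun x hx => ?_) z
  simp [PhiMap, hj, hx]

theorem exists_off (f g : ℤ → ℤ) (hg : StrictMono g) (h0 : ∀ z, f z ≤ g z) :
    ∃ d : ℕ, (∀ z, f z ≤ g (z - d)) ∧ ¬ ∀ z, f z ≤ g (z - d - 1) := by
  classical
  have key : ∀ d : ℕ, g (0 - d) ≤ g 0 - d := by
    intro d
    induction d with
    | zero => simp
    | succ k ih =>
      have := hg (show (0 : ℤ) - ((k + 1 : ℕ) : ℤ) < 0 - k by push_cast; omega)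
      push_cast at this ⊢
      omega
  have hex : ∃ d : ℕ, ¬ ∀ z, f z ≤ g (z - d) := by
    refine ⟨(g 0 - f 0 + 1).toNat, fun h => ?_⟩
    have h1 := h 0
    have h2 := key (g 0 - f 0 + 1).toNat
    have h3 := h0 0
    omega
  have hspec := Nat.find_spec hex
  have hmin := fun m => Nat.find_min hex (m := m)
  generalize Nat.find hex = N at hspec hmin
  cases N with
  | zero => exact absurd (by simpa using h0) hspec
  | succ k =>
    refine ⟨k, not_not.mp (hmin k (by omega)), fun h => hspec fun z => ?_⟩
    have := h z
    rw [show z - ((k + 1 : ℕ) : ℤ) = z - k - 1 by push_cast; ring]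
    exact this

theorem off_unique (f g : ℤ → ℤ) (hg : StrictMono g) (d e : ℤ)
    (hd : ∀ z, f z ≤ g (z - d)) (hd' : ¬ ∀ z, f z ≤ g (z - d - 1))
    (he : ∀ z, f z ≤ g (z - e)) (he' : ¬ ∀ z, f z ≤ g (z - e - 1)) : d = e := by
  rcases lt_trichotomy d e with h | h | h
  · exact absurd (fun z => (he z).trans (hg.monotone (by omega))) hd'
  · exact h
  · exact absurd (fun z => (hd z).trans (hg.monotone (by omega))) he'

/-- The inverse relation. -/
theorem off_of_phi (n a b : ℕ) (hb : 1 ≤ b) (T S : ℕ → ℕ → ℤ) (ν : ℕ → ℕ)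
    (hT : InBnR0 n a b T) (hS : PhiMap n a b T ν = S) (j : ℕ) (hj : j + 1 < a) :
    (∀ z, colExt n b (S (j + 1)) z ≤ colExt n b (S j) (z - ((ν (j + 1) : ℤ) - ν (j + 2)))) ∧
    ¬ ∀ z, colExt n b (S (j + 1)) z ≤
      colExt n b (S j) (z - ((ν (j + 1) : ℤ) - ν (j + 2)) - 1) := by
  subst hS
  rw [inBnR0_iff n a b hb, inBnR_iff n a b hb] at hT
  obtain ⟨⟨h1, -, -⟩, h2⟩ := hT
  simp only [phi_ext n a b hb T ν (j + 1) hj, phi_ext n a b hb T ν j (by omega)]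
  refine ⟨fun z => ?_, fun h => h2 j hj fun z => ?_⟩
  · refine (h1 j hj _).trans (le_of_eq ?_)
    congr 1; ring
  · have := h (z - ν (j + 2))
    convert this using 2 <;> ring

end helpers

/-- For a rectangle `R = (a^b)` with `a ≥ 1` and
`1 ≤ b ≤ n`, the map `(T, ν) ↦ τ_n^{ν_rev}(T)` is a bijection from
`B_n(R)₀ × 𝒫_{a-1}` onto `B_n(R)`. -/
theorem B0_times_partitions_bijection (n a b : ℕ) (hn : 0 < n)
    (ha : 1 ≤ a) (hb : 1 ≤ b) (hbn : b ≤ n) :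
    (∀ (T : ℕ → ℕ → ℤ) (ν : ℕ → ℕ), InBnR0 n a b T → IsPartLen a ν →
      InBnR n a b (PhiMap n a b T ν)) ∧
    ∀ S : ℕ → ℕ → ℤ, InBnR n a b S →
      ∃! p : (ℕ → ℕ → ℤ) × (ℕ → ℕ),
        InBnR0 n a b p.1 ∧ IsPartLen a p.2 ∧ PhiMap n a b p.1 p.2 = S := by
  refine ⟨fun T ν hT hν => ?_, fun S hS => ?_⟩
  · have hT' := hT
    rw [inBnR0_iff n a b hb, inBnR_iff n a b hb] at hT'
    obtain ⟨⟨h1, h2, h3⟩, -⟩ := hT'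
    rw [inBnR_iff n a b hb]
    refine ⟨fun j hj z => ?_, fun j hj => ?_, fun j x h => ?_⟩
    · rw [phi_ext n a b hb T ν (j + 1) hj, phi_ext n a b hb T ν j (by omega)]
      refine (h1 j hj _).trans ((h2 j (by omega)).monotone ?_)
      have : ν (j + 1 + 1) ≤ ν (j + 1) := by
        by_cases h : j + 1 + 2 ≤ a
        · exact hν.2.1 (j + 1) (by omega) h
        · rw [hν.2.2 (j + 1 + 1) (by omega)]; omega
      omega
    · intro z w hzw
      rw [phi_ext n a b hb T ν j hj, phi_ext n a b hb T ν j hj]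
      exact h2 j hj (by omega)
    · unfold PhiMap
      rw [if_neg (by omega)]
  · have hS' := hS
    rw [inBnR_iff n a b hb] at hS'
    obtain ⟨h1, h2, h3⟩ := hS'
    have hoff : ∀ j : ℕ, ∃ d : ℕ, j + 1 < a →
        (∀ z, colExt n b (S (j + 1)) z ≤ colExt n b (S j) (z - d)) ∧
        ¬ ∀ z, colExt n b (S (j + 1)) z ≤ colExt n b (S j) (z - d - 1) := by
      intro j
      by_cases hj : j + 1 < a
      · obtain ⟨d, hd⟩ := exists_off _ _ (h2 j (by omega)) (h1 j hj)
        exact ⟨d, fun _ => hd⟩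
      · exact ⟨0, fun h => absurd h hj⟩
    choose D hD using hoff
    let ν : ℕ → ℕ := fun j => if j = 0 then 0 else ∑ u ∈ Finset.Ico j a, D (u - 1)
    have hνa : ∀ j, a ≤ j → ν j = 0 := by
      intro j hj
      have : j ≠ 0 := by omega
      simp [ν, this, Finset.Ico_eq_empty_of_le hj]
    have hνs : ∀ j, j + 1 < a → ν (j + 1) = D j + ν (j + 2) := by
      intro j hj
      simp only [ν]
      rw [if_neg (by omega), if_neg (by omega), Finset.sum_eq_sum_Ico_succ_bot hj]
      simp
    let T : ℕ → ℕ → ℤ := fun j x =>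
      if j < a ∧ x < b then tauPow n b (-(ν (j + 1) : ℤ)) (S j) x else 0
    have hTe : ∀ j, j < a → ∀ z, colExt n b (T j) z = colExt n b (S j) (z + -(ν (j + 1) : ℤ)) := by
      intro j hj z
      refine ext_shift n b hb _ _ _ (fun x hx => ?_) z
      simp [T, hj, hx]
    refine ⟨(T, ν), ⟨?_, ?_, ?_⟩, ?_⟩
    · rw [inBnR0_iff n a b hb, inBnR_iff n a b hb]
      refine ⟨⟨fun j hj z => ?_, fun j hj => ?_, fun j x h => ?_⟩, fun j hj h => ?_⟩
      · show colExt n b (T (j + 1)) z ≤ colExt n b (T j) z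
        rw [hTe _ hj, hTe j (by omega)]
        refine ((hD j hj).1 _).trans (le_of_eq ?_)
        rw [hνs j hj]
        congr 1; push_cast; ring
      · intro z w hzw
        show colExt n b (T j) z < colExt n b (T j) w
        rw [hTe j hj, hTe j hj]
        exact h2 j hj (by omega)
      · show T j x = 0
        simp only [T]
        rw [if_neg (by omega)]
      · refine (hD j hj).2 fun z => ?_
        have := h (z + ν (j + 2))
        change colExt n b (T (j + 1)) _ ≤ colExt n b (T j) _ at this
        rw [hTe _ hj, hTe j (by omega), hνs j hj] at this
        convert this using 2 <;> push_cast <;> ring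
    · refine ⟨by simp [ν], fun j hj1 hj2 => ?_, hνa⟩
      obtain ⟨i, rfl⟩ : ∃ i, j = i + 1 := ⟨j - 1, by omega⟩
      have := hνs i (by omega)
      show ν (i + 2) ≤ ν (i + 1)
      omega
    · funext j x
      by_cases h : j < a ∧ x < b
      · have e := phi_ext n a b hb T ν j h.1 x
        rw [hTe j h.1, ext_nat n b _ x h.2] at e
        rw [show (x : ℤ) + ν (j + 1) + -(ν (j + 1) : ℤ) = x by ring, ext_nat n b _ x h.2] at e
        exact e
      · rw [h3 j x (by omega)]
        unfold PhiMap
        rw [if_neg h]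
    · rintro ⟨T', ν'⟩ ⟨hT', hν', hφ⟩
      simp only at hT' hν' hφ
      have hstep : ∀ j, j + 1 < a → ν' (j + 1) = D j + ν' (j + 2) := by
        intro j hj
        have ho := off_of_phi n a b hb T' S ν' hT' hφ j hj
        have := off_unique _ _ (h2 j (by omega)) _ _ ho.1 ho.2 (hD j hj).1 (hD j hj).2
        omega
      have hall : ∀ k j, a ≤ j + k → 1 ≤ j → ν' j = ν j := by
        intro k
        induction k with
        | zero => intro j h _; rw [hνa j (by omega), hν'.2.2 j (by omega)]
        | succ k ih =>
          intro j h hj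
          by_cases hja : a ≤ j
          · rw [hνa j hja, hν'.2.2 j hja]
          · obtain ⟨i, rfl⟩ : ∃ i, j = i + 1 := ⟨j - 1, by omega⟩
            rw [hstep i (by omega), hνs i (by omega), ih (i + 2) (by omega) (by omega)]
      have hνν : ν' = ν := by
        funext j
        by_cases hj : j = 0
        · subst hj; rw [hν'.1]; simp [ν]
        · exact hall a j (by omega) (by omega)
      rw [hνν] at hφ ⊢
      refine Prod.ext ?_ rfl
      funext j x
      show T' j x = T j x
      by_cases h : j < a ∧ x < b
      · have e := phi_ext n a b hb T' ν j h.1 ((x : ℤ) + -(ν (j + 1) : ℤ))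
        rw [hφ, show (x : ℤ) + -(ν (j + 1) : ℤ) + ν (j + 1) = x by ring,
          ext_nat n b _ x h.2] at e
        have e2 := hTe j h.1 x
        rw [ext_nat n b _ x h.2] at e2
        rw [e2, ← e]
      · have := hT'.1.2.2.2 j x (by omega)
        rw [this]
        simp only [T]
        rw [if_neg h]

end AffineRSK
end
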